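/- arXiv:1411.3366 — 2 statements merged into one kernel-verified Lean document; each statement's English description precedes it below -/
import Mathlib

section
/- For each metric space M containing a thick family of uv-geodesics (for some points u, v ∈ M) there exists a Banach space X which fails the Radon–Nikodým property (i.e., X carries a uniformly bounded X-valued martingale that does not converge in L¹) and such that M does not admit a bilipschitz embedding into X. -/
noncomputable section

open Set MeasureTheory

/-- `g : ℝ → M` is a `uv`-geodesic: a distance preserving map of `[0, d(u,v)]` onto a
path from `u` to `v` (extended to all of `ℝ` by the constant values `u`, `v`). -/
structure IsUVGeodesic {M : Type} [MetricSpace M] (u v : M) (g : ℝ → M) : Prop where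
  left : ∀ t : ℝ, t ≤ 0 → g t = u
  right : ∀ t : ℝ, dist u v ≤ t → g t = v
  isom : ∀ s ∈ Icc (0 : ℝ) (dist u v), ∀ t ∈ Icc (0 : ℝ) (dist u v),
    dist (g s) (g t) = |s - t|

/-- `T` is a thick family of `uv`-geodesics. -/
def IsThickFamily {M : Type} [MetricSpace M] (u v : M) (T : Set (ℝ → M)) : Prop :=
  T.Nonempty ∧ (∀ g ∈ T, IsUVGeodesic u v g) ∧
  ∃ α : ℝ, 0 < α ∧
    ∀ g ∈ T, ∀ (n : ℕ) (r : Fin n → ℝ), (∀ i, r i ∈ Icc (0 : ℝ) (dist u v)) →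
      ∃ g' ∈ T, ∃ (m : ℕ) (q : Fin (m + 1) → ℝ) (s : Fin m → ℝ),
        StrictMono q ∧ q 0 = 0 ∧ q (Fin.last m) = dist u v ∧
        (∀ i : Fin m, q i.castSucc < s i ∧ s i < q i.succ) ∧
        (∀ i : Fin (m + 1), g (q i) = g' (q i)) ∧
        (∀ i : Fin n, ∃ j : Fin (m + 1), g (r i) = g (q j)) ∧
        α ≤ ∑ i : Fin m, dist (g (s i)) (g' (s i)) ∧
        (∀ h : ℝ → M, IsUVGeodesic u v h →
          (∀ i : Fin m,
            (∀ t ∈ Icc (q i.castSucc) (q i.succ), h t = g t) ∨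
            (∀ t ∈ Icc (q i.castSucc) (q i.succ), h t = g' t)) →
          h ∈ T)

/-- `X` carries a uniformly bounded `X`-valued martingale that does not converge in `L¹`,
i.e. `X` fails the Radon–Nikodým property (martingale formulation). -/
def HasBoundedDivergentMartingale (X : Type) [NormedAddCommGroup X] [NormedSpace ℝ X]
    [CompleteSpace X] : Prop :=
  ∃ (Ω : Type) (mΩ : MeasurableSpace Ω) (μ : Measure Ω),
    IsProbabilityMeasure μ ∧
    ∃ (ℱ : Filtration ℕ mΩ) (f : ℕ → Ω → X),
      Martingale f ℱ μ ∧
      (∃ B : ℝ, ∀ (n : ℕ) (ω : Ω), ‖f n ω‖ ≤ B) ∧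
      ¬ ∃ g : Ω → X, Integrable g μ ∧
          Filter.Tendsto (fun n => ∫ ω, ‖f n ω - g ω‖ ∂μ) Filter.atTop (nhds 0)

namespace RNPTree

/-- A list is a node of the tree with branching numbers `N` (most recent branch first). -/
def IsNode (N : ℕ → ℕ) : List ℕ → Prop
  | [] => True
  | i :: t => i < N t.length ∧ IsNode N t

/-- Functions on the tree whose increments at every node are exponentially concentrated. -/
structure IsAdmissible (N : ℕ → ℕ) (γ : ℕ → ℝ) (φ : List ℕ → ℝ) : Prop where
  root : φ [] = 0
  abs_le_one : ∀ t, |φ t| ≤ 1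
  const : ∀ i t, ¬ IsNode N (i :: t) → φ (i :: t) = φ t
  sum_le : ∀ t, ∑ i ∈ Finset.range (N t.length),
    (Real.exp (γ t.length * |φ (i :: t) - φ t|) - 1) ≤ Real.exp (γ t.length)

/-- The function `φ` frozen after level `n`. -/
def truncate (n : ℕ) (φ : List ℕ → ℝ) : List ℕ → ℝ
  | [] => φ []
  | i :: t => if t.length < n then φ (i :: t) else truncate n φ t

/-- The function on the tree with increments `J`. -/
def accum (J : ℕ → List ℕ → ℝ) : List ℕ → ℝ
  | [] => 0
  | i :: t => accum J t + J i t

variable {N : ℕ → ℕ} {γ : ℕ → ℝ} {φ : List ℕ → ℝ}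

lemma truncate_of_length_le {n : ℕ} {t : List ℕ} (h : t.length ≤ n) : truncate n φ t = φ t := by
  cases t with
  | nil => rfl
  | cons i t => simp only [List.length_cons] at h; simp [truncate]; omega

lemma truncate_cons_sub (n : ℕ) (i : ℕ) (t : List ℕ) :
    truncate n φ (i :: t) - truncate n φ t = if t.length < n then φ (i :: t) - φ t else 0 := by
  by_cases h : t.length < n
  · simp [truncate, h, truncate_of_length_le h.le]
  · simp [truncate, h]

namespace IsAdmissible

lemma zero : IsAdmissible N γ (fun _ => 0) where
  root := rfl
  abs_le_one := by simp
  const := by simp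
  sum_le t := by simp [Real.exp_nonneg]

lemma neg (h : IsAdmissible N γ φ) : IsAdmissible N γ (fun t => -φ t) where
  root := by simp [h.root]
  abs_le_one t := by simpa using h.abs_le_one t
  const i t ht := by simp [h.const i t ht]
  sum_le t := by
    have : ∀ i, |-φ (i :: t) - -φ t| = |φ (i :: t) - φ t| := fun i => by
      rw [← abs_neg]; congr 1; ring
    simpa only [this] using h.sum_le t

lemma truncate (h : IsAdmissible N γ φ) (n : ℕ) : IsAdmissible N γ (truncate n φ) where
  root := h.root
  abs_le_one t := by
    induction t with
    | nil => exact h.abs_le_one []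
    | cons i t ih =>
      simp only [RNPTree.truncate]
      split_ifs
      exacts [h.abs_le_one _, ih]
  const i t ht := by
    rw [← sub_eq_zero, truncate_cons_sub, h.const i t ht]; simp
  sum_le t := by
    simp only [truncate_cons_sub]
    by_cases ht : t.length < n
    · simpa [ht] using h.sum_le t
    · simp [ht, Real.exp_nonneg]

open Classical in
lemma indicator {s : List ℕ} (hs : s ≠ []) (hN : IsNode N s) (hγ : ∀ j, 0 ≤ γ j) :
    IsAdmissible N γ (fun t => if s <:+ t then 1 else 0) where
  root := by simp [hs]
  abs_le_one t := by split_ifs <;> simp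
  const i t ht := by
    have : s ≠ i :: t := fun h => ht (h ▸ hN)
    simp [List.suffix_cons_iff, this]
  sum_le t := by
    obtain ⟨i₀, s₀, rfl⟩ := List.exists_cons_of_ne_nil hs
    have key : ∀ i, Real.exp (γ t.length * |(if i₀ :: s₀ <:+ i :: t then (1 : ℝ) else 0) -
        (if i₀ :: s₀ <:+ t then 1 else 0)|) - 1 ≤
        if i = i₀ then Real.exp (γ t.length) - 1 else 0 := by
      intro i
      by_cases h1 : i₀ :: s₀ <:+ t
      · have : i₀ :: s₀ <:+ i :: t := List.suffix_cons_iff.2 (Or.inr h1)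
        simp only [h1, this, if_true, sub_self, abs_zero, mul_zero, Real.exp_zero]
        split_ifs
        · linarith [Real.one_le_exp (hγ t.length)]
        · exact le_rfl
      · by_cases h2 : i₀ :: s₀ = i :: t
        · obtain ⟨rfl, rfl⟩ := List.cons.inj h2
          simp [h1]
        · have : ¬ i₀ :: s₀ <:+ i :: t := fun h =>
            (List.suffix_cons_iff.1 h).elim h2 h1
          simp only [h1, this, if_false, sub_self, abs_zero, mul_zero, Real.exp_zero]
          split_ifs
          · linarith [Real.one_le_exp (hγ t.length)]
          · exact le_rfl
    refine (Finset.sum_le_sum fun i _ => key i).trans ?_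
    rw [Finset.sum_ite_eq']
    split_ifs
    · linarith
    · exact Real.exp_nonneg _

/-- The damping argument: finitely many admissible functions, restricted to high levels, can be
added to any admissible function which has been damped on a small set. -/
lemma exists_damping {ι : Type*} [Fintype ι] [Nonempty ι] {θ : ι → List ℕ → ℝ}
    (hθ : ∀ i, IsAdmissible N γ (θ i)) (hγ : ∀ j, 0 ≤ γ j) {n : ℕ} {ε : ℕ → ℝ} {e : ℝ}
    (hε : ∀ j, 0 ≤ ε j) (he : ∀ m, ∑ j ∈ Finset.Ico n m, ε j ≤ e)
    (hcard : ∀ j, n ≤ j → (Fintype.card ι : ℝ) ≤ Real.exp (2 * γ j * ε j)) :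
    ∃ w : List ℕ → ℝ, (∀ t, t.length ≤ n → w t = 0) ∧
      ∀ φ, IsAdmissible N γ φ → ∀ i, ∀ c : ℝ, |c| ≤ 1 →
        IsAdmissible N γ (fun t => ((1 - w t) * RNPTree.truncate n φ t +
          c * ((θ i t - RNPTree.truncate n (θ i) t) / 2)) / (1 + e)) := by
  have he0 : 0 ≤ e := by simpa using he n
  set J : ℕ → List ℕ → ℝ := fun a t => if t.length < n then 0 else
    Finset.univ.sup' Finset.univ_nonempty
      (fun k => max (|θ k (a :: t) - θ k t| / 2 - ε t.length) 0) with hJ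
  have hJ0 : ∀ a t, 0 ≤ J a t := by
    intro a t
    simp only [hJ]
    split_ifs
    · exact le_rfl
    · obtain ⟨k⟩ := ‹Nonempty ι›
      exact (le_max_right _ _).trans (Finset.le_sup' (fun k => max (|θ k (a :: t) - θ k t| / 2 -
        ε t.length) 0) (Finset.mem_univ k))
  have hJle : ∀ a t, ¬ t.length < n → ∀ k, |θ k (a :: t) - θ k t| / 2 ≤ J a t + ε t.length := by
    intro a t ht k
    simp only [hJ, if_neg ht]
    have := (le_max_left _ _).trans (Finset.le_sup' (fun k => max (|θ k (a :: t) - θ k t| / 2 -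
        ε t.length) 0) (Finset.mem_univ k))
    linarith
  have hJex : ∀ a t, ¬ t.length < n → Real.exp (γ t.length * (2 * J a t)) - 1 ≤
      ∑ k, Real.exp (-(2 * γ t.length * ε t.length)) *
        (Real.exp (γ t.length * |θ k (a :: t) - θ k t|) - 1) := by
    intro a t ht
    have hnn : ∀ k, 0 ≤ Real.exp (-(2 * γ t.length * ε t.length)) *
        (Real.exp (γ t.length * |θ k (a :: t) - θ k t|) - 1) := fun k =>
      mul_nonneg (Real.exp_nonneg _) (sub_nonneg.2 (Real.one_le_exp
        (mul_nonneg (hγ _) (abs_nonneg _))))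
    obtain ⟨k, -, hk⟩ := Finset.exists_mem_eq_sup' (Finset.univ_nonempty (α := ι))
      (fun k => max (|θ k (a :: t) - θ k t| / 2 - ε t.length) 0)
    refine le_trans ?_ (Finset.single_le_sum (fun k _ => hnn k) (Finset.mem_univ k))
    simp only [hJ, if_neg ht, hk]
    rcases le_total (|θ k (a :: t) - θ k t| / 2 - ε t.length) 0 with h | h
    · rw [max_eq_right h]
      simpa using hnn k
    · rw [max_eq_left h]
      have h1 : Real.exp (-(2 * γ t.length * ε t.length)) ≤ 1 :=
        Real.exp_le_one_iff.2 (by have := mul_nonneg (hγ t.length) (hε t.length); linarith)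
      have h2 : γ t.length * (2 * (|θ k (a :: t) - θ k t| / 2 - ε t.length)) =
        -(2 * γ t.length * ε t.length) + γ t.length * |θ k (a :: t) - θ k t| := by ring
      rw [h2, Real.exp_add, mul_sub]; linarith
  have hJc : ∀ a t, ¬ IsNode N (a :: t) → J a t = 0 := by
    intro a t hat
    refine le_antisymm ?_ (hJ0 a t)
    simp only [hJ]
    split_ifs
    · exact le_rfl
    · refine Finset.sup'_le _ _ fun k _ => ?_
      simp [(hθ k).const a t hat, hε]
  have hA0 : ∀ t, 0 ≤ accum J t := by
    intro t
    induction t with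
    | nil => exact le_rfl
    | cons i t ih => exact add_nonneg ih (hJ0 i t)
  have hAn : ∀ t, t.length ≤ n → accum J t = 0 := by
    intro t
    induction t with
    | nil => intro _; rfl
    | cons i t ih =>
      intro h
      simp only [List.length_cons] at h
      have h1 : J i t = 0 := by simp only [hJ, if_pos (show t.length < n by omega)]
      rw [accum, ih (by omega), h1, add_zero]
  set κ : ι → List ℕ → ℝ := fun k t => (θ k t - RNPTree.truncate n (θ k) t) / 2 with hκ
  have hκ1 : ∀ k t, |κ k t| ≤ 1 := by
    intro k t
    have h1 := abs_le.1 ((hθ k).abs_le_one t)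
    have h2 := abs_le.1 (((hθ k).truncate n).abs_le_one t)
    simp only [hκ]
    rw [abs_le]; constructor <;> linarith [h1.1, h1.2, h2.1, h2.2]
  have hκd : ∀ k a t, κ k (a :: t) - κ k t =
      if t.length < n then 0 else (θ k (a :: t) - θ k t) / 2 := by
    intro k a t
    have := truncate_cons_sub (φ := θ k) n a t
    simp only [hκ]
    split_ifs with h <;> simp only [h, if_true, if_false] at this <;> linarith
  have hκA : ∀ k t, |κ k t| ≤ accum J t + ∑ j ∈ Finset.Ico n t.length, ε j := by
    intro k t
    induction t with
    | nil => simp [hκ, RNPTree.truncate, accum]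
    | cons a t ih =>
      have hd := hκd k a t
      simp only [accum, List.length_cons]
      by_cases h : t.length < n
      · rw [if_pos h] at hd
        rw [Finset.Ico_eq_empty_of_le (by omega : t.length ≤ n)] at ih
        rw [Finset.Ico_eq_empty_of_le (by omega : t.length + 1 ≤ n)]
        rw [show κ k (a :: t) = κ k t by linarith]
        linarith [hJ0 a t]
      · rw [if_neg h] at hd
        rw [Finset.sum_Ico_succ_top (by omega)]
        have h3 := hJle a t h k
        have h4 : |κ k (a :: t)| ≤ |κ k t| + |θ k (a :: t) - θ k t| / 2 := by
          rw [show κ k (a :: t) = κ k t + (θ k (a :: t) - θ k t) / 2 by linarith]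
          refine (abs_add_le _ _).trans ?_
          rw [abs_div (θ k (a :: t) - θ k t), abs_two]
        linarith
  set w : List ℕ → ℝ := fun t => min 1 (accum J t) with hw
  have hw0 : ∀ t, 0 ≤ w t := fun t => le_min zero_le_one (hA0 t)
  have hw1 : ∀ t, w t ≤ 1 := fun t => min_le_left _ _
  have hwd : ∀ a t, |w (a :: t) - w t| ≤ J a t := by
    intro a t
    have := abs_min_sub_min_le_max 1 (accum J (a :: t)) 1 (accum J t)
    rw [sub_self, abs_zero, max_eq_right (abs_nonneg _), accum, add_sub_cancel_left,
      abs_of_nonneg (hJ0 a t)] at this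
    exact this
  refine ⟨w, fun t ht => by simp [hw, hAn t ht], fun φ hφ i c hc => ?_⟩
  have hsφ := hφ.truncate n
  refine ⟨?_, fun t => ?_, fun a t hat => ?_, fun t => ?_⟩
  · simp [RNPTree.truncate, hφ.root]
  · rw [abs_div, abs_of_pos (by linarith : 0 < 1 + e), div_le_one (by linarith)]
    have h1 : |(1 - w t) * RNPTree.truncate n φ t| ≤ 1 - w t := by
      rw [abs_mul, abs_of_nonneg (by linarith [hw1 t] : 0 ≤ 1 - w t)]
      exact mul_le_of_le_one_right (by linarith [hw1 t]) (hsφ.abs_le_one t)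
    have h2 : |c * κ i t| ≤ |κ i t| := by
      rw [abs_mul]; exact mul_le_of_le_one_left (abs_nonneg _) hc
    have h3 : |κ i t| ≤ w t + e := by
      have h5 := (hκA i t).trans (add_le_add_right (he t.length) _)
      simp only [hw]
      rcases le_total 1 (accum J t) with h | h
      · rw [min_eq_left h]; linarith [hκ1 i t]
      · rw [min_eq_right h]; exact h5
    have h4 := abs_add_le ((1 - w t) * RNPTree.truncate n φ t) (c * κ i t)
    simp only [hκ] at h4 h2 h3
    linarith
  · have h1 := hκd i a t
    rw [(hθ i).const a t hat] at h1
    have h2 := hwd a t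
    rw [hJc a t hat] at h2
    have h3 : w (a :: t) = w t := by
      have := abs_nonpos_iff.1 h2; linarith
    have h4 : κ i (a :: t) = κ i t := by
      have : κ i (a :: t) - κ i t = 0 := by rw [h1]; simp
      linarith
    simp only [hκ] at h4
    simp only [h3, h4, hsφ.const a t hat]
  · by_cases ht : t.length < n
    · refine le_trans (Finset.sum_le_sum fun a _ => ?_) (hφ.sum_le t)
      have h3 : w (a :: t) = 0 := by simp [hw, hAn (a :: t) (by simpa using ht)]
      have h4 : w t = 0 := by simp [hw, hAn t ht.le]
      have hat : (a :: t).length ≤ n := by simpa using ht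
      rw [h3, h4, truncate_of_length_le (φ := φ) ht.le, truncate_of_length_le (φ := φ) hat,
        truncate_of_length_le (φ := θ i) ht.le, truncate_of_length_le (φ := θ i) hat]
      refine sub_le_sub_right (Real.exp_le_exp.2 (mul_le_mul_of_nonneg_left ?_ (hγ _))) _
      have h5 : ((1 - 0) * φ (a :: t) + c * ((θ i (a :: t) - θ i (a :: t)) / 2)) / (1 + e) -
          ((1 - 0) * φ t + c * ((θ i t - θ i t) / 2)) / (1 + e) =
          (φ (a :: t) - φ t) / (1 + e) := by ring
      rw [h5, abs_div, abs_of_pos (by linarith : 0 < 1 + e)]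
      exact div_le_self (abs_nonneg _) (by linarith)
    · have hstep : ∀ a ∈ Finset.range (N t.length),
          Real.exp (γ t.length * |((1 - w (a :: t)) * RNPTree.truncate n φ (a :: t) +
            c * ((θ i (a :: t) - RNPTree.truncate n (θ i) (a :: t)) / 2)) / (1 + e) -
            ((1 - w t) * RNPTree.truncate n φ t +
            c * ((θ i t - RNPTree.truncate n (θ i) t) / 2)) / (1 + e)|) - 1 ≤
          ((∑ k, Real.exp (-(2 * γ t.length * ε t.length)) *
            (Real.exp (γ t.length * |θ k (a :: t) - θ k t|) - 1)) +
            (Real.exp (γ t.length * |θ i (a :: t) - θ i t|) - 1)) / 2 := by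
        intro a _
        have h1 := hκd i a t
        rw [if_neg ht] at h1
        have h2 := truncate_cons_sub (φ := φ) n a t
        rw [if_neg ht, sub_eq_zero] at h2
        rw [h2]
        have h3 : ((1 - w (a :: t)) * RNPTree.truncate n φ t + c * κ i (a :: t)) / (1 + e) -
            ((1 - w t) * RNPTree.truncate n φ t + c * κ i t) / (1 + e) =
            (-(w (a :: t) - w t) * RNPTree.truncate n φ t + c * (κ i (a :: t) - κ i t)) /
              (1 + e) := by
          ring
        have h4 : |((1 - w (a :: t)) * RNPTree.truncate n φ t + c * κ i (a :: t)) / (1 + e) -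
            ((1 - w t) * RNPTree.truncate n φ t + c * κ i t) / (1 + e)| ≤
            J a t + |θ i (a :: t) - θ i t| / 2 := by
          rw [h3, h1, abs_div, abs_of_pos (by linarith : 0 < 1 + e)]
          refine (div_le_self (abs_nonneg _) (by linarith)).trans ((abs_add_le _ _).trans ?_)
          rw [abs_mul, abs_mul, abs_neg, abs_div, abs_two]
          refine add_le_add ?_ ?_
          · exact (mul_le_of_le_one_right (abs_nonneg _) (hsφ.abs_le_one t)).trans (hwd a t)
          · exact mul_le_of_le_one_left (by positivity) hc
        have h5 : Real.exp (γ t.length * (J a t + |θ i (a :: t) - θ i t| / 2)) ≤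
            (Real.exp (γ t.length * (2 * J a t)) +
              Real.exp (γ t.length * |θ i (a :: t) - θ i t|)) / 2 := by
          have e1 : Real.exp (γ t.length * (2 * J a t)) = Real.exp (γ t.length * J a t) ^ 2 := by
            rw [← Real.exp_nat_mul]; congr 1; push_cast; ring
          have e2 : Real.exp (γ t.length * |θ i (a :: t) - θ i t|) =
              Real.exp (γ t.length * (|θ i (a :: t) - θ i t| / 2)) ^ 2 := by
            rw [← Real.exp_nat_mul]; congr 1; push_cast; ring
          rw [e1, e2, mul_add, Real.exp_add]
          nlinarith [sq_nonneg (Real.exp (γ t.length * J a t) -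
            Real.exp (γ t.length * (|θ i (a :: t) - θ i t| / 2)))]
        have h6 := hJex a t ht
        have h7 := Real.exp_le_exp.2 (mul_le_mul_of_nonneg_left h4 (hγ t.length))
        simp only [hκ] at h7
        linarith
      refine (Finset.sum_le_sum hstep).trans ?_
      rw [← Finset.sum_div, Finset.sum_add_distrib, Finset.sum_comm]
      have h8 : ∑ k, ∑ a ∈ Finset.range (N t.length), Real.exp (-(2 * γ t.length * ε t.length)) *
          (Real.exp (γ t.length * |θ k (a :: t) - θ k t|) - 1) ≤ Real.exp (γ t.length) := by
        calc _ ≤ ∑ _k : ι, Real.exp (-(2 * γ t.length * ε t.length)) * Real.exp (γ t.length) := by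
              refine Finset.sum_le_sum fun k _ => ?_
              rw [← Finset.mul_sum]
              exact mul_le_mul_of_nonneg_left ((hθ k).sum_le t) (Real.exp_nonneg _)
          _ = (Fintype.card ι : ℝ) * Real.exp (-(2 * γ t.length * ε t.length)) *
                Real.exp (γ t.length) := by
              rw [Finset.sum_const, nsmul_eq_mul, Finset.card_univ]; ring
          _ ≤ 1 * Real.exp (γ t.length) := by
              refine mul_le_mul_of_nonneg_right ?_ (Real.exp_nonneg _)
              rw [Real.exp_neg, ← div_eq_mul_inv, div_le_one (Real.exp_pos _)]
              exact hcard _ (not_lt.1 ht)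
          _ = _ := one_mul _
      linarith [(hθ i).sum_le t]

end IsAdmissible

variable {N : ℕ → ℕ} {γ : ℕ → ℝ}

variable (N γ) in
/-- The set of admissible functions, with the discrete topology. -/
def AdmFun : Type := {φ : List ℕ → ℝ // IsAdmissible N γ φ}

instance : TopologicalSpace (AdmFun N γ) := ⊥

instance : DiscreteTopology (AdmFun N γ) := ⟨rfl⟩

variable (N γ) in
/-- Evaluation of admissible functions at a node. -/
def ev (t : List ℕ) : BoundedContinuousFunction (AdmFun N γ) ℝ :=
  BoundedContinuousFunction.ofNormedAddCommGroupDiscrete (fun φ => φ.1 t) 1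
    (fun φ => φ.2.abs_le_one t)

variable (N γ) in
/-- The closed span of the evaluations at the nodes, in the supremum norm. -/
def treeSubmodule : Submodule ℝ (BoundedContinuousFunction (AdmFun N γ) ℝ) :=
  (Submodule.span ℝ (range (ev N γ))).topologicalClosure

variable (N γ) in
/-- The Banach space `treeSubmodule N γ`. -/
def TreeSpace : Type := treeSubmodule N γ

instance : NormedAddCommGroup (TreeSpace N γ) :=
  inferInstanceAs (NormedAddCommGroup (treeSubmodule N γ))

instance : NormedSpace ℝ (TreeSpace N γ) :=
  inferInstanceAs (NormedSpace ℝ (treeSubmodule N γ))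

instance : CompleteSpace (TreeSpace N γ) :=
  inferInstanceAs (CompleteSpace (Submodule.span ℝ (range (ev N γ))).topologicalClosure)

variable (N γ) in
/-- The evaluation at a node as an element of the tree space. -/
def node (t : List ℕ) : TreeSpace N γ :=
  ⟨ev N γ t, Submodule.le_topologicalClosure _ (Submodule.subset_span (mem_range_self t))⟩

namespace TreeSpace

/-- The pairing of an element of the tree space with an admissible function. -/
def pair (φ : AdmFun N γ) : TreeSpace N γ →ₗ[ℝ] ℝ where
  toFun x := x.1 φ
  map_add' _ _ := rfl
  map_smul' _ _ := rfl

@[simp] lemma pair_node (φ : AdmFun N γ) (t : List ℕ) : pair φ (node N γ t) = φ.1 t := rfl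

lemma abs_pair_le (φ : AdmFun N γ) (x : TreeSpace N γ) : |pair φ x| ≤ ‖x‖ :=
  BoundedContinuousFunction.norm_coe_le_norm x.1 φ

lemma pair_le (φ : AdmFun N γ) (x : TreeSpace N γ) : pair φ x ≤ ‖x‖ :=
  (le_abs_self _).trans (abs_pair_le φ x)

lemma norm_le {x : TreeSpace N γ} {C : ℝ} (hC : 0 ≤ C) (h : ∀ φ, |pair φ x| ≤ C) : ‖x‖ ≤ C :=
  (BoundedContinuousFunction.norm_le hC).2 h

/-- Linear relations between admissible functions pass to the pairings. -/
lemma pair_eq_sum {ι : Type*} (s : Finset ι) (c : ι → ℝ) (φ : ι → AdmFun N γ) (ψ : AdmFun N γ)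
    (h : ∀ t, ψ.1 t = ∑ i ∈ s, c i * (φ i).1 t) (x : TreeSpace N γ) :
    pair ψ x = ∑ i ∈ s, c i * pair (φ i) x := by
  let S : Submodule ℝ (BoundedContinuousFunction (AdmFun N γ) ℝ) :=
    { carrier := {y | y ψ = ∑ i ∈ s, c i * y (φ i)}
      add_mem' := fun {a b} ha hb => by
        simp only [mem_ofPred_eq, BoundedContinuousFunction.coe_add, Pi.add_apply] at *
        rw [ha, hb, ← Finset.sum_add_distrib]
        exact Finset.sum_congr rfl fun i _ => by ring
      zero_mem' := by simp
      smul_mem' := fun r a ha => by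
        simp only [mem_ofPred_eq, BoundedContinuousFunction.coe_smul, smul_eq_mul] at *
        rw [ha, Finset.mul_sum]
        exact Finset.sum_congr rfl fun i _ => by ring }
  have hcont : ∀ φ : AdmFun N γ,
      Continuous fun y : BoundedContinuousFunction (AdmFun N γ) ℝ => y φ := fun φ =>
    continuous_eval_const φ
  have hS : IsClosed (S : Set (BoundedContinuousFunction (AdmFun N γ) ℝ)) :=
    isClosed_eq (hcont ψ) (continuous_finsetSum _ fun i _ => continuous_const.mul (hcont (φ i)))
  have hle : treeSubmodule N γ ≤ S := by
    refine Submodule.topologicalClosure_minimal _ (Submodule.span_le.2 ?_) hS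
    rintro _ ⟨t, rfl⟩
    exact h t
  exact hle x.2

lemma exists_pair_lt {x : TreeSpace N γ} {c : ℝ} (hc : c < ‖x‖) : ∃ φ, c < pair φ x := by
  by_contra! H
  have h1 : ∀ φ, |pair φ x| ≤ c := by
    intro φ
    refine abs_le.2 ⟨?_, H φ⟩
    have h2 := pair_eq_sum {()} (fun _ => -1) (fun _ => φ) (⟨_, φ.2.neg⟩ : AdmFun N γ)
      (by simp) x
    have h3 := H ⟨_, φ.2.neg⟩
    simp only [Finset.sum_singleton] at h2
    linarith
  have h0 : 0 ≤ c := (abs_nonneg _).trans (h1 ⟨_, IsAdmissible.zero⟩)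
  exact absurd (norm_le h0 h1) (not_le.2 hc)

lemma exists_pair_ge (x : TreeSpace N γ) {η : ℝ} (hη : 0 < η) :
    ∃ φ, (1 - η) * ‖x‖ ≤ pair φ x := by
  rcases (norm_nonneg x).eq_or_lt with h | h
  · refine ⟨⟨_, IsAdmissible.zero⟩, ?_⟩
    have h0 := abs_le.1 (abs_pair_le (⟨_, IsAdmissible.zero⟩ : AdmFun N γ) x)
    rw [← h] at h0 ⊢
    linarith [h0.1]
  · obtain ⟨φ, hφ⟩ := exists_pair_lt (x := x) (c := (1 - η) * ‖x‖) (by nlinarith)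
    exact ⟨φ, hφ.le⟩

/-- Elements of the tree space are approximated by elements depending on finitely many levels. -/
lemma exists_approx (x : TreeSpace N γ) {η : ℝ} (hη : 0 < η) :
    ∃ (y : TreeSpace N γ) (n : ℕ), ‖x - y‖ ≤ η ∧ ∀ (c : ℝ) (φ ψ : AdmFun N γ),
      (∀ t : List ℕ, t.length ≤ n → ψ.1 t = c * φ.1 t) → pair ψ y = c * pair φ y := by
  obtain ⟨y, hy, hxy⟩ := Metric.mem_closure_iff.1 x.2 η hη
  refine ⟨⟨y, Submodule.le_topologicalClosure _ hy⟩, ?_⟩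
  have : ∃ n : ℕ, ∀ (c : ℝ) (φ ψ : AdmFun N γ),
      (∀ t : List ℕ, t.length ≤ n → ψ.1 t = c * φ.1 t) → y ψ = c * y φ := by
    clear hxy
    induction hy using Submodule.span_induction with
    | mem y hy =>
      obtain ⟨t, rfl⟩ := hy
      exact ⟨t.length, fun c φ ψ h => h t le_rfl⟩
    | zero => exact ⟨0, by simp⟩
    | add y z _ _ hy hz =>
      obtain ⟨n, hn⟩ := hy
      obtain ⟨m, hm⟩ := hz
      refine ⟨max n m, fun c φ ψ h => ?_⟩
      simp only [BoundedContinuousFunction.coe_add, Pi.add_apply]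
      rw [hn c φ ψ fun t ht => h t (ht.trans (le_max_left _ _)),
        hm c φ ψ fun t ht => h t (ht.trans (le_max_right _ _))]
      ring
    | smul r y _ hy =>
      obtain ⟨n, hn⟩ := hy
      refine ⟨n, fun c φ ψ h => ?_⟩
      simp only [BoundedContinuousFunction.coe_smul, smul_eq_mul]
      rw [hn c φ ψ h]
      ring
  obtain ⟨n, hn⟩ := this
  refine ⟨n, ?_, hn⟩
  rw [dist_eq_norm] at hxy
  exact hxy.le

end TreeSpace

variable (N) in
/-- The nodes of level `n`. -/
def level : ℕ → Finset (List ℕ)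
  | 0 => {[]}
  | n + 1 => (level n ×ˢ Finset.range (N n)).image fun p => p.2 :: p.1

lemma mem_level {n : ℕ} {s : List ℕ} : s ∈ level N n ↔ s.length = n ∧ IsNode N s := by
  induction n generalizing s with
  | zero =>
    simp only [level, Finset.mem_singleton, List.length_eq_zero_iff]
    exact ⟨fun h => ⟨h, h ▸ trivial⟩, fun h => h.1⟩
  | succ n ih =>
    cases s with
    | nil => simp [level]
    | cons i t =>
      simp only [level, Finset.mem_image, Finset.mem_product, Finset.mem_range, Prod.exists,
        List.cons.injEq, List.length_cons, Nat.add_right_cancel_iff, IsNode, ih]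
      constructor
      · rintro ⟨a, b, ⟨⟨h1, h2⟩, h3⟩, rfl, rfl⟩
        exact ⟨h1, h1 ▸ h3, h2⟩
      · rintro ⟨h1, h2, h3⟩
        exact ⟨t, i, ⟨⟨h1, h3⟩, h1 ▸ h2⟩, rfl, rfl⟩

variable (N) in
/-- The nodes of positive level at most `n`. -/
def nodes (n : ℕ) : Finset (List ℕ) := (Finset.range n).biUnion fun j => level N (j + 1)

lemma mem_nodes {n : ℕ} {s : List ℕ} :
    s ∈ nodes N n ↔ s ≠ [] ∧ s.length ≤ n ∧ IsNode N s := by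
  simp only [nodes, Finset.mem_biUnion, Finset.mem_range, mem_level]
  constructor
  · rintro ⟨j, hj, h1, h2⟩
    refine ⟨fun h => by simp [h] at h1, by omega, h2⟩
  · rintro ⟨h1, h2, h3⟩
    have := List.length_pos_iff.2 h1
    exact ⟨s.length - 1, by omega, by omega, h3⟩

lemma card_level_succ_le (n : ℕ) : (level N (n + 1)).card ≤ (level N n).card * N n := by
  refine Finset.card_image_le.trans ?_
  rw [Finset.card_product, Finset.card_range]

lemma card_nodes_le {W : ℕ → ℕ} (hW : ∀ n, W (n + 1) = W n + (W n + 1) * N n) (n : ℕ) :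
    (nodes N n).card ≤ W n := by
  suffices h : (nodes N n).card ≤ W n ∧ (level N n).card ≤ W n + 1 from h.1
  induction n with
  | zero => simp [nodes, level]
  | succ n ih =>
    have h1 : (level N (n + 1)).card ≤ (W n + 1) * N n :=
      (card_level_succ_le n).trans (Nat.mul_le_mul_right _ ih.2)
    have h2 : nodes N (n + 1) = level N (n + 1) ∪ nodes N n := by
      simp [nodes, Finset.range_add_one, Finset.biUnion_insert]
    rw [hW]
    constructor
    · rw [h2]
      exact (Finset.card_union_le _ _).trans (by omega)
    · omega

open Classical in
lemma truncate_eq_sum {φ : List ℕ → ℝ} (hφ : IsAdmissible N γ φ) (n : ℕ) (t : List ℕ) :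
    truncate n φ t = ∑ s ∈ nodes N n, (φ s - φ s.tail) * (if s <:+ t then 1 else 0) := by
  induction t with
  | nil =>
    rw [truncate, hφ.root]
    refine (Finset.sum_eq_zero fun s hs => ?_).symm
    simp [(mem_nodes.1 hs).1]
  | cons i t ih =>
    have h1 := truncate_cons_sub (φ := φ) n i t
    have h2 : ∀ s : List ℕ, (φ s - φ s.tail) * (if s <:+ i :: t then (1 : ℝ) else 0) =
        (φ s - φ s.tail) * (if s <:+ t then 1 else 0) +
          if s = i :: t then φ (i :: t) - φ t else 0 := by
      intro s
      by_cases hs : s = i :: t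
      · subst hs
        have : ¬ i :: t <:+ t := fun h => by simpa using h.length_le
        simp [this]
      · simp [List.suffix_cons_iff, hs]
    rw [Finset.sum_congr rfl fun s _ => h2 s, Finset.sum_add_distrib, ← ih, Finset.sum_ite_eq',
      ← sub_eq_iff_eq_add', h1]
    by_cases hN : IsNode N (i :: t)
    · simp only [mem_nodes, hN, List.length_cons, ne_eq, reduceCtorEq, not_false_eq_true,
        true_and, and_true, Nat.succ_le_iff]
    · rw [hφ.const i t hN]; simp

/-- The coordinate functional of a node. -/
def coord (hγ : ∀ j, 0 ≤ γ j) (s : List ℕ) : TreeSpace N γ →ₗ[ℝ] ℝ := by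
  classical
  exact if h : s ≠ [] ∧ IsNode N s then
    TreeSpace.pair ⟨_, IsAdmissible.indicator h.1 h.2 hγ⟩ else 0

lemma abs_coord_le (hγ : ∀ j, 0 ≤ γ j) (s : List ℕ) (x : TreeSpace N γ) :
    |coord hγ s x| ≤ ‖x‖ := by
  unfold coord
  split_ifs
  · exact TreeSpace.abs_pair_le _ x
  · simp

lemma abs_pair_truncate_le (hγ : ∀ j, 0 ≤ γ j) (φ : AdmFun N γ) (n : ℕ) (x : TreeSpace N γ) :
    |TreeSpace.pair ⟨_, φ.2.truncate n⟩ x| ≤ 2 * ∑ s ∈ nodes N n, |coord hγ s x| := by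
  classical
  have h := TreeSpace.pair_eq_sum (nodes N n).attach
    (fun s : {s // s ∈ nodes N n} => φ.1 s - φ.1 s.1.tail)
    (fun s : {s // s ∈ nodes N n} =>
      (⟨_, IsAdmissible.indicator (mem_nodes.1 s.2).1 (mem_nodes.1 s.2).2.2 hγ⟩ :
      AdmFun N γ)) ⟨_, φ.2.truncate n⟩ (fun t => by
        simp only [truncate_eq_sum φ.2 n t]
        exact (Finset.sum_attach (nodes N n) (fun s : List ℕ => (φ.1 s - φ.1 s.tail) *
          (if s <:+ t then (1 : ℝ) else 0))).symm) x
  have h2 : ∀ s ∈ nodes N n, |(φ.1 s - φ.1 s.tail) * coord hγ s x| ≤ 2 * |coord hγ s x| := by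
    intro s _
    rw [abs_mul]
    refine mul_le_mul_of_nonneg_right ?_ (abs_nonneg _)
    have h1 := abs_le.1 (φ.2.abs_le_one s)
    have h2 := abs_le.1 (φ.2.abs_le_one s.tail)
    rw [abs_le]; constructor <;> linarith [h1.1, h1.2, h2.1, h2.2]
  have h3 : TreeSpace.pair ⟨_, φ.2.truncate n⟩ x =
      ∑ s ∈ nodes N n, (φ.1 s - φ.1 s.tail) * coord hγ s x := by
    rw [h, ← Finset.sum_attach (nodes N n)
      (fun s : List ℕ => (φ.1 s - φ.1 s.tail) * coord hγ s x)]
    refine Finset.sum_congr rfl fun s _ => ?_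
    rw [coord, dif_pos ⟨(mem_nodes.1 s.2).1, (mem_nodes.1 s.2).2.2⟩]
  rw [h3, Finset.mul_sum]
  exact (Finset.abs_sum_le_sum_abs _ _).trans (Finset.sum_le_sum h2)

open ProbabilityTheory Filter Topology in
/-- A bounded tree martingale with separated increments, indexed by the nodes of a tree,
gives a bounded divergent martingale. -/
theorem hasBoundedDivergentMartingale_of_tree {X : Type} [NormedAddCommGroup X] [NormedSpace ℝ X]
    [CompleteSpace X] {N : ℕ → ℕ} (hN : ∀ j, 0 < N j) {v : List ℕ → X} {C δ : ℝ} (hδ : 0 < δ)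
    (hC : ∀ t, ‖v t‖ ≤ C)
    (havg : ∀ t, v t = (N t.length : ℝ)⁻¹ • ∑ i ∈ Finset.range (N t.length), v (i :: t))
    (hsep : ∀ i t, IsNode N (i :: t) → δ ≤ ‖v (i :: t) - v t‖) :
    HasBoundedDivergentMartingale X := by
  let _ : MeasurableSpace (List ℕ) := ⊤
  have : ∀ j, Nonempty (Fin (N j)) := fun j => ⟨⟨0, hN j⟩⟩
  let P : ∀ j, Measure (Fin (N j)) := fun j => (PMF.uniformOfFintype (Fin (N j))).toMeasure
  let Ω := ∀ j, Fin (N j)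
  let μ : Measure Ω := Measure.infinitePi P
  let Y : ℕ → Ω → ℕ := fun j ω => ω j
  have hY : ∀ j, Measurable (Y j) := fun j => by
    have : Measurable (fun i : Fin (N j) => (i : ℕ)) := measurable_of_finite _
    exact this.comp (measurable_pi_apply j)
  let ℱ : Filtration ℕ (inferInstance : MeasurableSpace Ω) :=
    Filtration.natural Y fun j => (hY j).stronglyMeasurable
  have hYF : ∀ j n, j ≤ n → Measurable[ℱ n] (Y j) := fun j n hj =>
    ((Filtration.stronglyAdapted_natural fun j => (hY j).stronglyMeasurable) j).measurable.mono
      (ℱ.mono hj) le_rfl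
  let Z : ℕ → Ω → List ℕ := fun n ω => Nat.rec [] (fun k t => Y k ω :: t) n
  have hZ : ∀ n ω, Z (n + 1) ω = Y n ω :: Z n ω := fun _ _ => rfl
  have hlen : ∀ n ω, (Z n ω).length = n := fun n ω => by
    induction n with
    | zero => rfl
    | succ n ih => rw [hZ, List.length_cons, ih]
  have hnode : ∀ n ω, IsNode N (Z n ω) := fun n ω => by
    induction n with
    | zero => trivial
    | succ n ih => exact ⟨by rw [hlen]; exact (ω n).2, ih⟩
  have hZF : ∀ n m, n ≤ m + 1 → Measurable[ℱ m] (Z n) := by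
    intro n m hn
    induction n with
    | zero => exact measurable_const
    | succ n ih =>
      have h1 : Measurable fun p : ℕ × List ℕ => p.1 :: p.2 := measurable_of_countable _
      exact h1.comp ((hYF n m (by omega)).prodMk (ih (by omega)))
  have hvF : ∀ (w : List ℕ → X) n m, n ≤ m + 1 → StronglyMeasurable[ℱ m] fun ω => w (Z n ω) :=
    fun w n m h => (StronglyMeasurable.of_discrete (f := w)).comp_measurable (hZF n m h)
  have hInt : ∀ (w : List ℕ → X), (∀ t, ‖w t‖ ≤ C) → ∀ n, Integrable (fun ω => w (Z n ω)) μ :=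
    fun w hw n => Integrable.of_bound
      ((hvF w n n (by omega)).mono (ℱ.le n)).aestronglyMeasurable C (ae_of_all _ fun ω => hw _)
  let f : ℕ → Ω → X := fun n ω => v (Z (n + 1) ω)
  have hmart : Martingale f ℱ μ := by
    refine martingale_nat (fun n => hvF v _ _ le_rfl) (fun n => hInt v hC (n + 1)) fun n => ?_
    let k := n + 1
    let c : Fin (N k) → Ω → ℝ := fun i ω => if Y k ω = i then 1 else 0
    have hcm : ∀ i, StronglyMeasurable[MeasurableSpace.comap (Y k) inferInstance] (c i) := by
      intro i
      have h1 : StronglyMeasurable fun j : ℕ => if j = i then (1 : ℝ) else 0 :=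
        StronglyMeasurable.of_discrete
      exact h1.comp_measurable (comap_measurable (Y k))
    have hcb : ∀ i ω, ‖c i ω‖ ≤ 1 := fun i ω => by
      simp only [c]; split_ifs <;> simp
    have hci : ∀ i, Integrable (c i) μ := fun i => Integrable.of_bound
      ((hcm i).mono (hY k).comap_le).aestronglyMeasurable 1 (ae_of_all _ (hcb i))
    have hcv : ∀ i : Fin (N k), Integrable (c i • fun ω => v (i :: Z k ω)) μ := fun i =>
      (hInt (fun t => v (i :: t)) (fun t => hC _) k).bdd_smul 1
        (hci i).aestronglyMeasurable (ae_of_all _ (hcb i))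
    have hfk : f (n + 1) = ∑ i : Fin (N k), c i • fun ω => v (i :: Z k ω) := by
      funext ω
      simp only [Finset.sum_apply, Pi.smul_apply', c, ite_smul, one_smul, zero_smul]
      rw [Finset.sum_eq_single (ω k)]
      · simp [f, hZ, Y, k]
      · intro i _ hi
        rw [if_neg fun h => hi (Fin.ext h.symm)]
      · simp
    have hind : iIndepFun Y μ := iIndepFun_infinitePi (P := P)
      (X := fun j (i : Fin (N j)) => (i : ℕ))
      (fun j => measurable_of_finite _)
    have hindep : Indep (MeasurableSpace.comap (Y k) inferInstance) (ℱ n) μ := by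
      have h1 : Indep (⨆ i ∈ ({k} : Set ℕ), MeasurableSpace.comap (Y i) inferInstance)
          (⨆ i ∈ {i | i ≤ n}, MeasurableSpace.comap (Y i) inferInstance) μ :=
        indep_iSup_of_disjoint (fun i => (hY i).comap_le) hind (by simp [k])
      rwa [iSup_singleton] at h1
    have hmean : ∀ i, ∫ ω, c i ω ∂μ = (N k : ℝ)⁻¹ := by
      intro i
      have h1 : MeasurePreserving (Function.eval k) μ (P k) := measurePreserving_eval_infinitePi P k
      have h2 := integral_map (μ := μ) h1.measurable.aemeasurable (StronglyMeasurable.of_discrete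
        (f := fun j : Fin (N k) => if (j : ℕ) = i then (1 : ℝ) else 0)).aestronglyMeasurable
      rw [h1.map_eq] at h2
      have h3 : ∫ j, (if (j : ℕ) = i then (1 : ℝ) else 0) ∂(P k) = (N k : ℝ)⁻¹ := by
        rw [PMF.integral_eq_sum, Finset.sum_eq_single i]
        · simp
        · intro j _ hj
          rw [if_neg fun h => hj (Fin.ext h)]; simp
        · simp
      rw [← h3, h2]
    have hce : ∀ i : Fin (N k), μ[c i • (fun ω => v (i :: Z k ω)) | ℱ n] =ᵐ[μ]
        fun ω => (N k : ℝ)⁻¹ • v (i :: Z k ω) := by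
      intro i
      have h1 := condExp_smul_of_aestronglyMeasurable_right (hci i) (hcv i)
        (hvF (fun t => v (i :: t)) k n le_rfl).aestronglyMeasurable
      have h2 := condExp_indep_eq (hY k).comap_le (ℱ.le n) (hcm i) hindep
      filter_upwards [h1, h2] with ω h1 h2
      rw [h1, Pi.smul_apply', h2, hmean]
    rw [hfk]
    have h1 := condExp_finsetSum (s := Finset.univ) (fun i _ => hcv i) (ℱ n)
    have h2 := eventually_all.2 hce
    filter_upwards [h1, h2] with ω h1 h2
    rw [h1, Finset.sum_apply, Finset.sum_congr rfl fun i _ => h2 i]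
    have h3 : (Z k ω).length = k := hlen k ω
    change v (Z k ω) = _
    rw [havg, h3, Finset.smul_sum, Finset.sum_range]
  refine ⟨Ω, inferInstance, μ, inferInstance, ℱ, f, hmart, ⟨C, fun n ω => hC _⟩, ?_⟩
  rintro ⟨g, hg, hlim⟩
  have hd : ∀ n, Integrable (fun ω => ‖f n ω - g ω‖) μ := fun n => ((hInt v hC (n + 1)).sub hg).norm
  have hsum := (hlim.comp (tendsto_add_atTop_nat 1)).add hlim
  rw [add_zero] at hsum
  refine absurd (ge_of_tendsto' hsum (b := δ) fun n => ?_) (not_le.2 hδ)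
  simp only [Function.comp_apply]
  rw [← integral_add (hd _) (hd _)]
  have h1 : ∫ _ : Ω, δ ∂μ = δ := by simp
  rw [← h1]
  refine integral_mono (integrable_const δ) ((hd _).add (hd _)) fun ω => ?_
  calc δ ≤ ‖f (n + 1) ω - f n ω‖ := hsep _ _ (hnode (n + 2) ω)
    _ = ‖(f (n + 1) ω - g ω) - (f n ω - g ω)‖ := by congr 1; abel
    _ ≤ _ := norm_sub_le _ _

/-- The average of a function over the children of a node. -/
def childAverage {X : Type*} [NormedAddCommGroup X] [NormedSpace ℝ X] (N : ℕ → ℕ)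
    (F : List ℕ → X) (t : List ℕ) : X :=
  (N t.length : ℝ)⁻¹ • ∑ i ∈ Finset.range (N t.length), F (i :: t)

lemma norm_childAverage_sub_le {X : Type*} [NormedAddCommGroup X] [NormedSpace ℝ X] {N : ℕ → ℕ}
    (hN : ∀ j, 0 < N j) {F G : List ℕ → X} {t : List ℕ} {c : ℝ}
    (h : ∀ i, ‖F (i :: t) - G (i :: t)‖ ≤ c) : ‖childAverage N F t - childAverage N G t‖ ≤ c := by
  have hpos : (0 : ℝ) < N t.length := Nat.cast_pos.2 (hN _)
  rw [childAverage, childAverage, ← smul_sub, ← Finset.sum_sub_distrib, norm_smul, norm_inv,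
    Real.norm_of_nonneg hpos.le, inv_mul_le_iff₀ hpos]
  refine (norm_sum_le_of_le _ fun i _ => h i).trans ?_
  simp

/-- The tree space fails the Radon-Nikodym property. -/
theorem hasBoundedDivergentMartingale_treeSpace {N : ℕ → ℕ} {γ : ℕ → ℝ} (hγ : ∀ j, 1 ≤ γ j)
    (hN : ∀ j, Real.exp (γ j) * 2 ^ j * 8 ≤ N j) :
    HasBoundedDivergentMartingale (TreeSpace N γ) := by
  have hN0 : ∀ j, 0 < N j := fun j => by
    have : (0 : ℝ) < N j := lt_of_lt_of_le (by positivity) (hN j)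
    exact_mod_cast this
  let A : ℕ → List ℕ → TreeSpace N γ := fun k => (childAverage N)^[k] (node N γ)
  have hA : ∀ k, A (k + 1) = childAverage N (A k) := fun k => Function.iterate_succ_apply' _ _ _
  have hstep : ∀ k t, ‖A (k + 1) t - A k t‖ ≤ 1 / 8 * (1 / 2) ^ (t.length + k) := by
    intro k
    induction k with
    | zero =>
      intro t
      refine TreeSpace.norm_le (by positivity) fun φ => ?_
      have hpos : (0 : ℝ) < N t.length := Nat.cast_pos.2 (hN0 _)
      have h1 : TreeSpace.pair φ (A (0 + 1) t - A 0 t) = (N t.length : ℝ)⁻¹ *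
          ∑ i ∈ Finset.range (N t.length), (φ.1 (i :: t) - φ.1 t) := by
        rw [hA]
        simp only [A, Function.iterate_zero, id, childAverage, map_sub, map_smul, map_sum,
          TreeSpace.pair_node, Finset.sum_sub_distrib, Finset.sum_const, Finset.card_range,
          smul_eq_mul, nsmul_eq_mul]
        field_simp
      have h2 : |∑ i ∈ Finset.range (N t.length), (φ.1 (i :: t) - φ.1 t)| ≤
          Real.exp (γ t.length) := by
        refine (Finset.abs_sum_le_sum_abs _ _).trans (le_trans (Finset.sum_le_sum fun i _ => ?_)
          (φ.2.sum_le t))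
        have h3 := Real.add_one_le_exp (γ t.length * |φ.1 (i :: t) - φ.1 t|)
        have h4 := mul_le_mul_of_nonneg_right (hγ t.length) (abs_nonneg (φ.1 (i :: t) - φ.1 t))
        linarith
      rw [h1, abs_mul, abs_inv, abs_of_pos hpos, inv_mul_le_iff₀ hpos, add_zero, one_div_pow]
      refine h2.trans ?_
      have h3 := hN t.length
      have h4 : (0 : ℝ) < 2 ^ t.length := by positivity
      rw [show (N t.length : ℝ) * (1 / 8 * (1 / 2 ^ t.length)) =
        N t.length / (2 ^ t.length * 8) by field_simp, le_div_iff₀ (by positivity)]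
      linarith
    | succ k ih =>
      intro t
      rw [hA (k + 1)]
      nth_rewrite 2 [hA k]
      refine norm_childAverage_sub_le hN0 fun i => (ih (i :: t)).trans_eq ?_
      rw [List.length_cons]; congr 2; omega
  have hdist : ∀ t k, dist (A k t) (A (k + 1) t) ≤ 1 / 8 * (1 / 2) ^ k := fun t k => by
    rw [dist_comm, dist_eq_norm]
    refine (hstep k t).trans ?_
    rw [pow_add]
    have : (1 / 2 : ℝ) ^ t.length ≤ 1 := pow_le_one₀ (by norm_num) (by norm_num)
    have : (0 : ℝ) < (1 / 2) ^ k := by positivity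
    nlinarith
  have hlim : ∀ t, ∃ x, Filter.Tendsto (fun k => A k t) Filter.atTop (nhds x) := fun t =>
    cauchySeq_tendsto_of_complete (cauchySeq_of_le_geometric _ _ (by norm_num) (hdist t))
  choose v hv using hlim
  have hv0 : ∀ t, ‖node N γ t - v t‖ ≤ 1 / 4 := fun t => by
    have := dist_le_of_le_geometric_of_tendsto₀ _ _ (by norm_num) (hdist t) (hv t)
    rw [dist_eq_norm] at this
    norm_num at this ⊢
    exact this
  have hnode : ∀ t, ‖node N γ t‖ ≤ 1 := fun t =>
    TreeSpace.norm_le zero_le_one fun φ => φ.2.abs_le_one t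
  refine hasBoundedDivergentMartingale_of_tree hN0 (v := v) (C := 5 / 4) (δ := 1 / 2)
    (by norm_num) (fun t => ?_) (fun t => ?_) fun i t hit => ?_
  · have h1 := norm_sub_norm_le (v t) (node N γ t)
    rw [norm_sub_rev] at h1
    linarith [hv0 t, hnode t]
  · refine tendsto_nhds_unique ((hv t).comp (Filter.tendsto_add_atTop_nat 1)) ?_
    simp only [Function.comp_def, hA, childAverage]
    exact (tendsto_finsetSum _ fun i _ => hv (i :: t)).const_smul _
  · have h1 : 1 ≤ ‖node N γ (i :: t) - node N γ t‖ := by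
      have hind := IsAdmissible.indicator (N := N) (γ := γ) (List.cons_ne_nil i t) hit
        fun j => zero_le_one.trans (hγ j)
      obtain ⟨ψ, hψ⟩ : ∃ ψ : AdmFun N γ, ∀ s, ψ.1 s = if i :: t <:+ s then 1 else 0 :=
        ⟨⟨_, hind⟩, fun _ => rfl⟩
      have h2 := TreeSpace.pair_le ψ (node N γ (i :: t) - node N γ t)
      have h3 : ¬ i :: t <:+ t := fun h => by simpa using h.length_le
      rw [map_sub, TreeSpace.pair_node, TreeSpace.pair_node, hψ, hψ] at h2
      simpa only [List.suffix_refl, if_true, h3, if_false, sub_zero] using h2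
    have h2 : node N γ (i :: t) - node N γ t = (v (i :: t) - v t) +
        (node N γ (i :: t) - v (i :: t)) - (node N γ t - v t) := by abel
    rw [h2] at h1
    have h3 := norm_sub_le ((v (i :: t) - v t) + (node N γ (i :: t) - v (i :: t)))
      (node N γ t - v t)
    have h4 := norm_add_le (v (i :: t) - v t) (node N γ (i :: t) - v (i :: t))
    linarith [hv0 t, hv0 (i :: t)]

lemma sum_range_two_mul (f : ℕ → ℝ) (m : ℕ) :
    ∑ i ∈ Finset.range (2 * m), f i = ∑ i ∈ Finset.range m, (f (2 * i) + f (2 * i + 1)) := by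
  induction m with
  | zero => simp
  | succ m ih => rw [Finset.sum_range_succ, ← ih, show 2 * (m + 1) = 2 * m + 1 + 1 by ring,
      Finset.sum_range_succ, Finset.sum_range_succ, add_assoc]

lemma sum_blocks {E : Type*} [AddCommMonoid E] {ι : ℕ → ℕ} {n : ℕ}
    (hι : ∀ i < n, ι i ≤ ι (i + 1)) (f : ℕ → E) :
    ι 0 ≤ ι n ∧
      ∑ i ∈ Finset.range n, ∑ j ∈ Finset.Ico (ι i) (ι (i + 1)), f j =
        ∑ j ∈ Finset.Ico (ι 0) (ι n), f j := by
  induction n with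
  | zero => simp
  | succ n ih =>
    obtain ⟨h1, h2⟩ := ih fun i hi => hι i (by omega)
    have h3 := hι n (by omega)
    exact ⟨h1.trans h3, by rw [Finset.sum_range_succ, h2, Finset.sum_Ico_consecutive _ h1 h3]⟩

/-- The identity behind the energy gain when an interval is split in two. -/
lemma sq_div_add_sq_div_ge {a b x z : ℝ} (ha : 0 < a) (hb : 0 < b) :
    (x + z) ^ 2 / (a + b) + 4 * ((x - a / (a + b) * (x + z)) ^ 2 / (a + b)) ≤
      x ^ 2 / a + z ^ 2 / b := by
  have h1 : x ^ 2 / a + z ^ 2 / b - (x + z) ^ 2 / (a + b) =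
      (x - a / (a + b) * (x + z)) ^ 2 * ((a + b) / (a * b)) := by
    field_simp
    ring
  have h2 : 4 / (a + b) ≤ (a + b) / (a * b) := by
    rw [div_le_div_iff₀ (by positivity) (by positivity)]
    nlinarith [sq_nonneg (a - b)]
  have h3 := mul_le_mul_of_nonneg_left h2 (sq_nonneg (x - a / (a + b) * (x + z)))
  have h4 : 4 * ((x - a / (a + b) * (x + z)) ^ 2 / (a + b)) =
      (x - a / (a + b) * (x + z)) ^ 2 * (4 / (a + b)) := by ring
  linarith

/-- A sequence of curves on `[0, D]` in a normed space that agree on successively refined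
partitions and deviate, at every step, from their piecewise linear interpolations. -/
structure Ladder (X : Type*) [NormedAddCommGroup X] [NormedSpace ℝ X] (D L δ : ℝ) where
  /-- number of intervals of the partition -/
  m : ℕ → ℕ
  /-- the partition points -/
  Q : ℕ → ℕ → ℝ
  /-- the points inside the intervals of the partition -/
  S : ℕ → ℕ → ℝ
  /-- the curves -/
  G : ℕ → ℝ → X
  Q_zero : ∀ k, Q k 0 = 0
  Q_last : ∀ k, Q k (m k) = D
  Q_lt : ∀ k, ∀ i < m k, Q k i < S k i
  S_lt : ∀ k, ∀ i < m k, S k i < Q k (i + 1)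
  lip : ∀ k, ∀ s ∈ Icc 0 D, ∀ t ∈ Icc 0 D, ‖G k t - G k s‖ ≤ L * |t - s|
  matchQ : ∀ k, ∀ i ≤ m k, ∃ j ≤ m (k + 1), Q (k + 1) j = Q k i
  matchS : ∀ k, ∀ i < m k, ∃ j ≤ m (k + 1), Q (k + 1) j = S k i
  agree : ∀ k, ∀ j ≤ m (k + 1), G (k + 1) (Q (k + 1) j) = G k (Q (k + 1) j)
  gain : ∀ k, δ ≤ ∑ i ∈ Finset.range (m k), ‖G k (S k i) - G k (Q k i) -
    ((S k i - Q k i) / (Q k (i + 1) - Q k i)) • (G k (Q k (i + 1)) - G k (Q k i))‖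

namespace Ladder

variable {X : Type*} [NormedAddCommGroup X] [NormedSpace ℝ X] {D L δ : ℝ} (F : Ladder X D L δ)

/-- The deviation from the linear interpolation. -/
def u (k i : ℕ) : X := F.G k (F.S k i) - F.G k (F.Q k i) -
    ((F.S k i - F.Q k i) / (F.Q k (i + 1) - F.Q k i)) • (F.G k (F.Q k (i + 1)) - F.G k (F.Q k i))

/-- The partition refined by the inner points. -/
def R (k I : ℕ) : ℝ := if I % 2 = 0 then F.Q k (I / 2) else F.S k (I / 2)

lemma R_even (k i : ℕ) : F.R k (2 * i) = F.Q k i := by simp [R]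

lemma R_odd (k i : ℕ) : F.R k (2 * i + 1) = F.S k i := by
  have h1 : (2 * i + 1) % 2 = 1 := by omega
  have h2 : (2 * i + 1) / 2 = i := by omega
  simp [R, h1, h2]

lemma R_even' (k i : ℕ) : F.R k (2 * i + 1 + 1) = F.Q k (i + 1) := F.R_even k (i + 1)

/-- The increments over the refined partition. -/
def Δ (k I : ℕ) : X := F.G k (F.R k (I + 1)) - F.G k (F.R k I)

lemma R_lt {k I : ℕ} (hI : I < 2 * F.m k) : F.R k I < F.R k (I + 1) := by
  obtain ⟨i, rfl | rfl⟩ := Nat.even_or_odd' I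
  · rw [R_even, R_odd]; exact F.Q_lt k i (by omega)
  · rw [R_odd, R_even']; exact F.S_lt k i (by omega)

lemma Q_step {k i : ℕ} (hi : i < F.m k) : F.Q k i < F.Q k (i + 1) :=
  (F.Q_lt k i hi).trans (F.S_lt k i hi)

lemma Q_strict {k i j : ℕ} (hij : i < j) (hj : j ≤ F.m k) : F.Q k i < F.Q k j := by
  induction j, hij using Nat.le_induction with
  | base => exact F.Q_step (by omega)
  | succ j _ ih => exact (ih (by omega)).trans (F.Q_step (by omega))

lemma lt_of_Q_lt {k i j : ℕ} (hi : i ≤ F.m k) (h : F.Q k i < F.Q k j) : i < j := by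
  by_contra! hij
  rcases hij.eq_or_lt with rfl | hij
  · exact lt_irrefl _ h
  · exact lt_asymm h (F.Q_strict hij hi)

lemma Q_mem {k i : ℕ} (hi : i ≤ F.m k) : F.Q k i ∈ Icc 0 D := by
  constructor
  · rcases i.eq_zero_or_pos with rfl | h
    · exact (F.Q_zero k).ge
    · exact (F.Q_zero k).symm.trans_le (F.Q_strict h hi).le
  · rcases hi.eq_or_lt with rfl | h
    · exact (F.Q_last k).le
    · exact (F.Q_strict h le_rfl).le.trans_eq (F.Q_last k)

lemma S_mem {k i : ℕ} (hi : i < F.m k) : F.S k i ∈ Icc 0 D :=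
  ⟨(F.Q_mem hi.le).1.trans (F.Q_lt k i hi).le, (F.S_lt k i hi).le.trans (F.Q_mem hi).2⟩

lemma R_mem {k I : ℕ} (hI : I ≤ 2 * F.m k) : F.R k I ∈ Icc 0 D := by
  obtain ⟨i, rfl | rfl⟩ := Nat.even_or_odd' I
  · rw [R_even]; exact F.Q_mem (by omega)
  · rw [R_odd]; exact F.S_mem (by omega)

lemma sum_R (k : ℕ) : ∑ I ∈ Finset.range (2 * F.m k), (F.R k (I + 1) - F.R k I) = D := by
  have h0 : F.R k 0 = F.Q k 0 := F.R_even k 0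
  rw [Finset.sum_range_sub, R_even, h0, F.Q_last, F.Q_zero, sub_zero]

lemma norm_Δ_le {k I : ℕ} (hI : I < 2 * F.m k) : ‖F.Δ k I‖ ≤ L * (F.R k (I + 1) - F.R k I) := by
  refine (F.lip k _ (F.R_mem hI.le) _ (F.R_mem hI)).trans_eq ?_
  rw [abs_of_pos (sub_pos.2 (F.R_lt hI))]

/-- The length of the polygon inscribed at the refined partition. -/
def V (k : ℕ) : ℝ := ∑ I ∈ Finset.range (2 * F.m k), ‖F.Δ k I‖

lemma V_nonneg (k : ℕ) : 0 ≤ F.V k := Finset.sum_nonneg fun _ _ => norm_nonneg _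

lemma V_le (k : ℕ) : F.V k ≤ L * D := by
  refine (Finset.sum_le_sum fun I hI => F.norm_Δ_le (Finset.mem_range.1 hI)).trans_eq ?_
  rw [← Finset.mul_sum, F.sum_R]

lemma exists_index {k l : ℕ} (hkl : k < l) :
    ∀ I ≤ 2 * F.m k, ∃ j ≤ F.m l, F.Q l j = F.R k I ∧ F.G l (F.Q l j) = F.G k (F.R k I) := by
  induction l, hkl using Nat.le_induction with
  | base =>
    intro I hI
    obtain ⟨j, hj, h⟩ : ∃ j ≤ F.m (k + 1), F.Q (k + 1) j = F.R k I := by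
      obtain ⟨i, rfl | rfl⟩ := Nat.even_or_odd' I
      · rw [R_even]; exact F.matchQ k i (by omega)
      · rw [R_odd]; exact F.matchS k i (by omega)
    exact ⟨j, hj, h, by rw [F.agree k j hj, h]⟩
  | succ l _ ih =>
    intro I hI
    obtain ⟨j, hj, h1, h2⟩ := ih I hI
    obtain ⟨i, hi, h⟩ := F.matchQ l j hj
    exact ⟨i, hi, h.trans h1, by rw [F.agree l i hi, h, h2]⟩

/-- Every refined partition is a coarsening of all later partitions. -/
lemma exists_index_map {k l : ℕ} (hkl : k < l) :
    ∃ ι : ℕ → ℕ, (∀ I < 2 * F.m k, ι I < ι (I + 1)) ∧ ι 0 = 0 ∧ ι (2 * F.m k) = F.m l ∧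
      (∀ I ≤ 2 * F.m k, ι I ≤ F.m l ∧ F.Q l (ι I) = F.R k I ∧
        F.G l (F.Q l (ι I)) = F.G k (F.R k I)) := by
  have h := F.exists_index hkl
  choose! ι h1 h2 h3 using h
  refine ⟨ι, fun I hI => ?_, ?_, ?_, fun I hI => ⟨h1 I hI, h2 I hI, h3 I hI⟩⟩
  · refine F.lt_of_Q_lt (h1 I hI.le) ?_
    rw [h2 I hI.le, h2 (I + 1) hI]
    exact F.R_lt hI
  · by_contra h
    have h4 := F.Q_strict (k := l) (Nat.pos_of_ne_zero h) (h1 0 (Nat.zero_le _))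
    rw [h2 0 (Nat.zero_le _), F.Q_zero, show F.R k 0 = F.Q k 0 from F.R_even k 0, F.Q_zero] at h4
    exact lt_irrefl _ h4
  · by_contra h
    have h4 := F.Q_strict (k := l) (lt_of_le_of_ne (h1 _ le_rfl) h) le_rfl
    rw [h2 _ le_rfl, R_even, F.Q_last, F.Q_last] at h4
    exact lt_irrefl _ h4

/-- The energy of a scalar projection of the curve over the refined partition. -/
def energy (c : X →ₗ[ℝ] ℝ) (k : ℕ) : ℝ :=
  ∑ I ∈ Finset.range (2 * F.m k), c (F.Δ k I) ^ 2 / (F.R k (I + 1) - F.R k I)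

/-- The energy of a scalar projection of the deviations. -/
def defect (c : X →ₗ[ℝ] ℝ) (k : ℕ) : ℝ :=
  ∑ i ∈ Finset.range (F.m k), c (F.u k i) ^ 2 / (F.Q k (i + 1) - F.Q k i)

lemma energy_nonneg (c : X →ₗ[ℝ] ℝ) (k : ℕ) : 0 ≤ F.energy c k :=
  Finset.sum_nonneg fun _ hI => div_nonneg (sq_nonneg _)
    (sub_pos.2 (F.R_lt (Finset.mem_range.1 hI))).le

lemma defect_nonneg (c : X →ₗ[ℝ] ℝ) (k : ℕ) : 0 ≤ F.defect c k :=
  Finset.sum_nonneg fun _ hI => div_nonneg (sq_nonneg _)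
    (sub_pos.2 (F.Q_step (Finset.mem_range.1 hI))).le

lemma energy_le {c : X →ₗ[ℝ] ℝ} (hc : ∀ x, |c x| ≤ ‖x‖) (k : ℕ) :
    F.energy c k ≤ L ^ 2 * D := by
  have h0 : L ^ 2 * D = ∑ I ∈ Finset.range (2 * F.m k), L ^ 2 * (F.R k (I + 1) - F.R k I) := by
    rw [← Finset.mul_sum, F.sum_R]
  rw [h0]
  refine Finset.sum_le_sum fun I hI => ?_
  have hI := Finset.mem_range.1 hI
  have h1 := sub_pos.2 (F.R_lt hI)
  rw [div_le_iff₀ h1, ← sq_abs]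
  calc |c (F.Δ k I)| ^ 2 ≤ (L * (F.R k (I + 1) - F.R k I)) ^ 2 :=
        pow_le_pow_left₀ (abs_nonneg _) ((hc _).trans (F.norm_Δ_le hI)) 2
    _ = _ := by ring

lemma energy_add_defect_le (c : X →ₗ[ℝ] ℝ) (k : ℕ) :
    F.energy c k + 4 * F.defect c (k + 1) ≤ F.energy c (k + 1) := by
  obtain ⟨ι, hι, h0, hlast, h⟩ := F.exists_index_map (show k < k + 1 by omega)
  let g : ℕ → ℝ := fun i =>
    c (F.G (k + 1) (F.Q (k + 1) (i + 1)) - F.G (k + 1) (F.Q (k + 1) i)) ^ 2 /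
      (F.Q (k + 1) (i + 1) - F.Q (k + 1) i)
  have h1 : F.energy c k ≤ ∑ i ∈ Finset.range (F.m (k + 1)), g i := by
    have h2 := (sum_blocks (fun i hi => (hι i hi).le) g).2
    rw [h0, hlast, ← Finset.range_eq_Ico] at h2
    rw [← h2]
    refine Finset.sum_le_sum fun I hI => ?_
    have hI := Finset.mem_range.1 hI
    obtain ⟨-, h3, h4⟩ := h I hI.le
    obtain ⟨h5, h6, h7⟩ := h (I + 1) hI
    have h8 := Finset.sq_sum_div_le_sum_sq_div (Finset.Ico (ι I) (ι (I + 1)))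
      (fun i => c (F.G (k + 1) (F.Q (k + 1) (i + 1)) - F.G (k + 1) (F.Q (k + 1) i)))
      (g := fun i => F.Q (k + 1) (i + 1) - F.Q (k + 1) i) fun i hi =>
        sub_pos.2 (F.Q_step ((Finset.mem_Ico.1 hi).2.trans_le h5))
    rw [← map_sum, Finset.sum_Ico_sub _ (hι I hI).le,
      Finset.sum_Ico_sub (fun i => F.G (k + 1) (F.Q (k + 1) i)) (hι I hI).le, h4, h7, h3, h6] at h8
    exact h8
  have h2 : ∑ i ∈ Finset.range (F.m (k + 1)), g i + 4 * F.defect c (k + 1) ≤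
      F.energy c (k + 1) := by
    rw [energy, sum_range_two_mul, defect, Finset.mul_sum, ← Finset.sum_add_distrib]
    refine Finset.sum_le_sum fun i hi => ?_
    have hi := Finset.mem_range.1 hi
    have h3 := sq_div_add_sq_div_ge (x := c (F.Δ (k + 1) (2 * i)))
      (z := c (F.Δ (k + 1) (2 * i + 1))) (sub_pos.2 (F.Q_lt _ i hi)) (sub_pos.2 (F.S_lt _ i hi))
    simp only [Δ, u, g, R_even, R_odd, R_even', map_sub, map_smul, smul_eq_mul] at h3 ⊢
    simp only [sub_add_sub_cancel'] at h3
    convert h3 using 6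
  linarith

end Ladder

variable {N : ℕ → ℕ} {γ : ℕ → ℝ} {D L δ : ℝ}

lemma TreeSpace.pair_add {ψ p θ σ : AdmFun N γ} {a b : ℝ}
    (h : ∀ t, ψ.1 t = p.1 t + a * θ.1 t + b * σ.1 t) (x : TreeSpace N γ) :
    pair ψ x = pair p x + a * pair θ x + b * pair σ x := by
  have := pair_eq_sum Finset.univ ![1, a, b] ![p, θ, σ] ψ
    (fun t => by simp [Fin.sum_univ_three, h]) x
  simpa [Fin.sum_univ_three] using this

namespace Ladder

variable (F : Ladder (TreeSpace N γ) D L δ)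

/-- Some step between `n` and `n + (n * (W + 1)) ^ 2` has small deviations as seen by the first
`n` levels of the tree. -/
lemma exists_small_defect (hγ : ∀ j, 0 ≤ γ j) (hL : 0 ≤ L) (hD : 0 ≤ D) {n W : ℕ} (hn : 0 < n)
    (hW : (nodes N n).card ≤ W) :
    ∃ k, n < k ∧ k ≤ n + (n * (W + 1)) ^ 2 ∧
      ∑ i ∈ Finset.range (F.m k), ∑ s ∈ nodes N n, |coord hγ s (F.u k i)| ≤ L * D / (2 * n) := by
  let E : ℕ → ℝ := fun k => ∑ s ∈ nodes N n, F.energy (coord hγ s) k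
  let d : ℕ → ℝ := fun k => ∑ s ∈ nodes N n, F.defect (coord hγ s) k
  have hWr : ((nodes N n).card : ℝ) ≤ W := Nat.cast_le.2 hW
  have hnr : (0 : ℝ) < n := Nat.cast_pos.2 hn
  have hstep : ∀ k, E k + 4 * d (k + 1) ≤ E (k + 1) := fun k => by
    simp only [E, d]
    rw [Finset.mul_sum, ← Finset.sum_add_distrib]
    exact Finset.sum_le_sum fun s _ => F.energy_add_defect_le _ k
  have hE : ∀ k, E k ≤ W * (L ^ 2 * D) := fun k => by
    refine (Finset.sum_le_sum fun s _ => F.energy_le (abs_coord_le hγ s) k).trans ?_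
    rw [Finset.sum_const, nsmul_eq_mul]
    exact mul_le_mul_of_nonneg_right hWr (by positivity)
  have hsum : ∀ J, ∑ j ∈ Finset.range J, 4 * d (n + j + 1) ≤ E (n + J) := fun J => by
    induction J with
    | zero => simpa using Finset.sum_nonneg fun s _ => F.energy_nonneg (coord hγ s) n
    | succ J ih =>
      rw [Finset.sum_range_succ]
      have := hstep (n + J)
      rw [← add_assoc]
      linarith
  obtain ⟨J, hJ⟩ : ∃ J, J = (n * (W + 1)) ^ 2 := ⟨_, rfl⟩
  have hJ0 : 0 < J := by rw [hJ]; positivity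
  have hJr : (0 : ℝ) < J := Nat.cast_pos.2 hJ0
  have hJr' : (J : ℝ) = (n * (W + 1)) ^ 2 := by rw [hJ]; push_cast; ring
  obtain ⟨j, hj, hdj⟩ := Finset.exists_le_of_sum_le (s := Finset.range J)
    (f := fun j => 4 * d (n + j + 1)) (g := fun _ => W * (L ^ 2 * D) / J)
    ⟨0, Finset.mem_range.2 hJ0⟩ (by
      rw [Finset.sum_const, Finset.card_range, nsmul_eq_mul, mul_div_cancel₀ _ hJr.ne']
      exact (hsum J).trans (hE _))
  have hj := Finset.mem_range.1 hj
  refine ⟨n + j + 1, by omega, by omega, ?_⟩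
  set k := n + j + 1
  have hQ : ∑ i ∈ Finset.range (F.m k), (F.Q k (i + 1) - F.Q k i) = D := by
    rw [Finset.sum_range_sub, F.Q_last, F.Q_zero, sub_zero]
  have hcs := Finset.sum_sq_le_sum_mul_sum_of_sq_le_mul (Finset.range (F.m k) ×ˢ nodes N n)
    (r := fun p => |coord hγ p.2 (F.u k p.1)|)
    (f := fun p => coord hγ p.2 (F.u k p.1) ^ 2 / (F.Q k (p.1 + 1) - F.Q k p.1))
    (g := fun p => F.Q k (p.1 + 1) - F.Q k p.1)
    (fun p hp => div_nonneg (sq_nonneg _)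
      (sub_pos.2 (F.Q_step (Finset.mem_range.1 (Finset.mem_product.1 hp).1))).le)
    (fun p hp => (sub_pos.2 (F.Q_step (Finset.mem_range.1 (Finset.mem_product.1 hp).1))).le)
    (fun p hp => by
      have := sub_pos.2 (F.Q_step (Finset.mem_range.1 (Finset.mem_product.1 hp).1))
      rw [sq_abs, div_mul_cancel₀ _ this.ne'])
  rw [Finset.sum_product, Finset.sum_product_right, Finset.sum_product_right] at hcs
  simp only [hQ, Finset.sum_const, nsmul_eq_mul] at hcs
  have hd0 : 0 ≤ d k := Finset.sum_nonneg fun s _ => F.defect_nonneg _ k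
  refine le_of_sq_le_sq ?_ (by positivity)
  have h1 : d k * ((nodes N n).card * D) ≤ d k * (W * D) := by gcongr
  have h2 : d k * (W * D) ≤ W * (L ^ 2 * D) / J / 4 * (W * D) := by
    gcongr
    linarith
  refine hcs.trans (h1.trans (h2.trans ?_))
  have h3 : (W : ℝ) * (L ^ 2 * D) / J / 4 * (W * D) =
      (L * D / (2 * n)) ^ 2 * ((W : ℝ) / (W + 1)) ^ 2 := by
    rw [hJr']; field_simp; norm_num
  rw [h3]
  have h4 : (W : ℝ) / (W + 1) ≤ 1 := by rw [div_le_one (by positivity)]; linarith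
  have h5 : ((W : ℝ) / (W + 1)) ^ 2 ≤ 1 := pow_le_one₀ (by positivity) h4
  exact mul_le_of_le_one_right (sq_nonneg _) h5

/-- The polygon at a later step `l` with small deviations on the first `n` levels is longer than
the polygon at step `k` by a definite amount. -/
lemma V_ge (hγ : ∀ j, 0 ≤ γ j) {k l n : ℕ} (hkl : k < l) {ε : ℕ → ℝ} {e : ℝ}
    (hε : ∀ j, 0 ≤ ε j) (he : ∀ m, ∑ j ∈ Finset.Ico n m, ε j ≤ e)
    (hcard : ∀ j, n ≤ j → (F.m l : ℝ) ≤ Real.exp (2 * γ j * ε j)) (hm : 0 < F.m l)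
    {η : ℝ} (hη : 0 < η) (hη1 : η ≤ 1)
    (happ : ∀ I < 2 * F.m k, ∃ y : TreeSpace N γ, ‖F.Δ k I - y‖ ≤ η / (2 * F.m k + 1) ∧
      ∀ (c : ℝ) (φ ψ : AdmFun N γ), (∀ t : List ℕ, t.length ≤ n → ψ.1 t = c * φ.1 t) →
        TreeSpace.pair ψ y = c * TreeSpace.pair φ y)
    (hsmall : ∑ i ∈ Finset.range (F.m l), ∑ s ∈ nodes N n, |coord hγ s (F.u l i)| ≤ η) :
    ((1 - η) * F.V k - η) / (1 + e) - η + ((1 - η) * δ - 2 * η) / (2 * (1 + e)) ≤ F.V l := by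
  have he0 : 0 ≤ e := by simpa using he n
  have he1 : 0 < 1 + e := by linarith
  have : Nonempty (Fin (F.m l)) := ⟨⟨0, hm⟩⟩
  choose θ hθ using fun i => TreeSpace.exists_pair_ge (F.u l i) hη
  choose φ hφ using fun I => TreeSpace.exists_pair_ge (F.Δ k I) hη
  obtain ⟨w, hw0, hw⟩ := IsAdmissible.exists_damping (ι := Fin (F.m l)) (θ := fun i => (θ i).1)
    (fun i => (θ i).2) hγ hε he (by simpa using hcard)
  have hp : ∀ I, ∃ p : AdmFun N γ, ∀ t, p.1 t = ((1 - w t) * truncate n (φ I).1 t) / (1 + e) :=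
    fun I => ⟨⟨_, hw _ (φ I).2 ⟨0, hm⟩ 0 (by simp)⟩, fun t => by simp⟩
  choose p hp using hp
  let κ : ℕ → ℝ := fun i => ((1 - η) * ‖F.u l i‖ - 2 * ∑ s ∈ nodes N n, |coord hγ s (F.u l i)|) /
    (2 * (1 + e))
  have hkey : ∀ I, ∀ i < F.m l,
      TreeSpace.pair (p I) (F.G l (F.Q l (i + 1)) - F.G l (F.Q l i)) + κ i ≤
        ‖F.Δ l (2 * i)‖ + ‖F.Δ l (2 * i + 1)‖ := by
    intro I i hi
    have ha := sub_pos.2 (F.Q_lt l i hi)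
    have hb := sub_pos.2 (F.S_lt l i hi)
    have hab : F.Q l (i + 1) - F.Q l i = (F.S l i - F.Q l i) + (F.Q l (i + 1) - F.S l i) := by ring
    have hx : F.Δ l (2 * i) = F.G l (F.S l i) - F.G l (F.Q l i) := by
      simp only [Δ, R_even, R_odd]
    have hz : F.Δ l (2 * i + 1) = F.G l (F.Q l (i + 1)) - F.G l (F.S l i) := by
      simp only [Δ, R_even', R_odd]
    have hY : F.G l (F.Q l (i + 1)) - F.G l (F.Q l i) = F.Δ l (2 * i) + F.Δ l (2 * i + 1) := by
      rw [hx, hz]; abel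
    have hu : F.u l i = F.Δ l (2 * i) - ((F.S l i - F.Q l i) / (F.Q l (i + 1) - F.Q l i)) •
        (F.Δ l (2 * i) + F.Δ l (2 * i + 1)) := by
      rw [← hY, hx, u]
    have hσ := (abs_le.1 (abs_pair_truncate_le hγ (θ i) n (F.u l i))).2
    have hθi := hθ i
    rw [hY]
    set a := F.S l i - F.Q l i
    set b := F.Q l (i + 1) - F.S l i
    rw [hab] at hu
    set x := F.Δ l (2 * i)
    set z := F.Δ l (2 * i + 1)
    set σ : AdmFun N γ := ⟨_, (θ i).2.truncate n⟩
    have hψ : ∀ c : ℝ, |c| ≤ 1 → ∀ y : TreeSpace N γ, TreeSpace.pair (p I) y +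
        c / (2 * (1 + e)) * (TreeSpace.pair (θ i) y - TreeSpace.pair σ y) ≤ ‖y‖ := by
      intro c hc y
      have h1 := hw _ (φ I).2 ⟨i, hi⟩ c hc
      obtain ⟨ψ, hψ⟩ : ∃ ψ : AdmFun N γ, ∀ t, ψ.1 t = ((1 - w t) * truncate n (φ I).1 t +
        c * (((θ i).1 t - truncate n (θ i).1 t) / 2)) / (1 + e) := ⟨⟨_, h1⟩, fun t => rfl⟩
      have h2 := TreeSpace.pair_add (ψ := ψ) (p := p I) (θ := θ i) (σ := σ)
        (a := c / (2 * (1 + e))) (b := -(c / (2 * (1 + e)))) (fun t => by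
          rw [hψ, hp]
          change _ = _ + _ + _ * truncate n (θ i).1 t
          field_simp
          ring) y
      have h3 := TreeSpace.pair_le ψ y
      linarith
    have h1 := hψ (b / (a + b)) (by
      rw [abs_of_pos (by positivity), div_le_one (by positivity)]; linarith) x
    have h2 := hψ (-(a / (a + b))) (by
      rw [abs_neg, abs_of_pos (by positivity), div_le_one (by positivity)]; linarith) z
    have h3 : ∀ f : TreeSpace N γ →ₗ[ℝ] ℝ, f (F.u l i) = b / (a + b) * f x - a / (a + b) * f z := by
      intro f
      rw [hu, map_sub, map_smul, map_add, smul_eq_mul]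
      field_simp
      ring
    have h4 : κ i ≤ (TreeSpace.pair (θ i) (F.u l i) - TreeSpace.pair σ (F.u l i)) /
        (2 * (1 + e)) := by
      refine div_le_div_of_nonneg_right ?_ (by positivity)
      linarith
    rw [h3, h3] at h4
    rw [map_add]
    have h5 : (b / (a + b) * TreeSpace.pair (θ i) x - a / (a + b) * TreeSpace.pair (θ i) z -
        (b / (a + b) * TreeSpace.pair σ x - a / (a + b) * TreeSpace.pair σ z)) / (2 * (1 + e)) =
        b / (a + b) / (2 * (1 + e)) * (TreeSpace.pair (θ i) x - TreeSpace.pair σ x) +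
        -(a / (a + b)) / (2 * (1 + e)) * (TreeSpace.pair (θ i) z - TreeSpace.pair σ z) := by
      field_simp
      ring
    linarith
  have hκ : ((1 - η) * δ - 2 * η) / (2 * (1 + e)) ≤ ∑ i ∈ Finset.range (F.m l), κ i := by
    simp only [κ]
    rw [← Finset.sum_div, Finset.sum_sub_distrib, ← Finset.mul_sum, ← Finset.mul_sum]
    refine div_le_div_of_nonneg_right ?_ (by positivity)
    have h1 := mul_le_mul_of_nonneg_left (F.gain l) (sub_nonneg.2 hη1)
    simp only [u] at hsmall ⊢
    linarith
  obtain ⟨ι, hι, h0, hlast, hιQ⟩ := F.exists_index_map hkl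
  have hblock : ∀ I < 2 * F.m k, TreeSpace.pair (p I) (F.Δ k I) +
      ∑ i ∈ Finset.Ico (ι I) (ι (I + 1)), κ i ≤
        ∑ i ∈ Finset.Ico (ι I) (ι (I + 1)), (‖F.Δ l (2 * i)‖ + ‖F.Δ l (2 * i + 1)‖) := by
    intro I hI
    obtain ⟨-, h3, h4⟩ := hιQ I hI.le
    obtain ⟨h5, h6, h7⟩ := hιQ (I + 1) hI
    have h8 := Finset.sum_Ico_sub (fun i => F.G l (F.Q l i)) (hι I hI).le
    rw [h4, h7] at h8
    rw [Δ, ← h8, map_sum, ← Finset.sum_add_distrib]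
    exact Finset.sum_le_sum fun i hi => hkey I i ((Finset.mem_Ico.1 hi).2.trans_le h5)
  have hpI : ∀ I < 2 * F.m k, (1 - η) / (1 + e) * ‖F.Δ k I‖ -
      (1 / (1 + e) + 1) * (η / (2 * F.m k + 1)) ≤ TreeSpace.pair (p I) (F.Δ k I) := by
    intro I hI
    obtain ⟨y, hy, hdep⟩ := happ I hI
    have h1 := hdep (1 / (1 + e)) (φ I) (p I) fun t ht => by
      rw [hp, hw0 t ht, truncate_of_length_le ht]; ring
    have h2 := (abs_le.1 (TreeSpace.abs_pair_le (φ I) (F.Δ k I - y))).2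
    have h3 := (abs_le.1 (TreeSpace.abs_pair_le (p I) (F.Δ k I - y))).1
    rw [map_sub] at h2 h3
    have h4 : 1 / (1 + e) * ((1 - η) * ‖F.Δ k I‖ - η / (2 * F.m k + 1)) ≤
        1 / (1 + e) * TreeSpace.pair (φ I) y :=
      mul_le_mul_of_nonneg_left (by linarith [hφ I]) (by positivity)
    have h5 : 1 / (1 + e) * ((1 - η) * ‖F.Δ k I‖ - η / (2 * F.m k + 1)) =
      (1 - η) / (1 + e) * ‖F.Δ k I‖ - 1 / (1 + e) * (η / (2 * F.m k + 1)) := by ring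
    linarith
  have hsum := Finset.sum_le_sum fun I hI => hblock I (Finset.mem_range.1 hI)
  have hsum2 := Finset.sum_le_sum fun I hI => hpI I (Finset.mem_range.1 hI)
  rw [Finset.sum_add_distrib, (sum_blocks (fun i hi => (hι i hi).le) _).2,
    (sum_blocks (fun i hi => (hι i hi).le) _).2, h0, hlast, ← Finset.range_eq_Ico,
    ← sum_range_two_mul (fun i => ‖F.Δ l i‖)] at hsum
  rw [Finset.sum_sub_distrib, ← Finset.mul_sum, Finset.sum_const, Finset.card_range,
    nsmul_eq_mul] at hsum2
  have h1 : ((2 * F.m k : ℕ) : ℝ) * ((1 / (1 + e) + 1) * (η / (2 * F.m k + 1))) ≤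
      (1 / (1 + e) + 1) * η := by
    push_cast
    have h2 : (2 * (F.m k : ℝ)) / (2 * F.m k + 1) ≤ 1 := by
      rw [div_le_one (by positivity)]; linarith
    calc (2 * (F.m k : ℝ)) * ((1 / (1 + e) + 1) * (η / (2 * F.m k + 1))) =
        (1 / (1 + e) + 1) * η * ((2 * (F.m k : ℝ)) / (2 * F.m k + 1)) := by ring
      _ ≤ _ := mul_le_of_le_one_right (by positivity) h2
  have h2 : ((1 - η) * F.V k - η) / (1 + e) - η =
      (1 - η) / (1 + e) * F.V k - (1 / (1 + e) + 1) * η := by ring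
  rw [h2]
  simp only [V] at hsum2 ⊢
  linarith

end Ladder

/-- For suitable parameters, the tree space contains no ladder of prescribed complexity. -/
theorem Ladder.false_of_le {N : ℕ → ℕ} {γ : ℕ → ℝ} {D L δ : ℝ} (F : Ladder (TreeSpace N γ) D L δ)
    (hγ : ∀ j, 0 ≤ γ j) (hδ : 0 < δ) (hL : 0 ≤ L) (hD : 0 ≤ D) {W a : ℕ → ℕ}
    (hW : ∀ n, (nodes N n).card ≤ W n) (ha : Monotone a) (hm : ∀ k, F.m k ≤ a k)
    (hcard : ∀ n j, n ≤ j →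
      (a (n + (n * (W n + 1)) ^ 2) : ℝ) ≤ Real.exp (2 * γ j * (1 / 2) ^ j)) : False := by
  have hLD : 0 ≤ L * D := mul_nonneg hL hD
  obtain ⟨η, hη⟩ : ∃ η, η = δ / (4 * (2 * (L * D) + 6 + δ)) := ⟨_, rfl⟩
  have hη0 : 0 < η := by rw [hη]; positivity
  have hηeq : η * (4 * (2 * (L * D) + 6 + δ)) = δ := by rw [hη]; field_simp
  have hη1 : η ≤ 1 := by
    rw [hη, div_le_one (by positivity)]; linarith
  obtain ⟨k, hk⟩ : ∃ k, ∀ l, F.V l ≤ F.V k + η := by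
    have hbdd : BddAbove (range F.V) := ⟨L * D, by rintro _ ⟨k, rfl⟩; exact F.V_le k⟩
    obtain ⟨k, hk⟩ := exists_lt_of_lt_ciSup (sub_lt_self (⨆ k, F.V k) hη0)
    exact ⟨k, fun l => by linarith [le_ciSup hbdd l]⟩
  have happ := fun I => TreeSpace.exists_approx (F.Δ k I)
    (show 0 < η / (2 * F.m k + 1) by positivity)
  choose y ny hy hdep using happ
  obtain ⟨n₂, hn₂⟩ := exists_nat_ge (L * D / (2 * η))
  obtain ⟨n₃, hn₃⟩ := exists_pow_lt_of_lt_one (half_pos hη0) (by norm_num : (1 / 2 : ℝ) < 1)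
  let n := max (k + 1) (max ((Finset.range (2 * F.m k)).sup ny) (max n₂ n₃))
  have hkn : k + 1 ≤ n := le_max_left _ _
  have hn1 : (Finset.range (2 * F.m k)).sup ny ≤ n := (le_max_left _ _).trans (le_max_right _ _)
  have hn2 : n₂ ≤ n := (le_max_left _ _).trans ((le_max_right _ _).trans (le_max_right _ _))
  have hn3 : n₃ ≤ n := (le_max_right _ _).trans ((le_max_right _ _).trans (le_max_right _ _))
  have hn0 : (0 : ℝ) < n := Nat.cast_pos.2 (by omega)
  obtain ⟨l, hnl, hlK, hl⟩ := F.exists_small_defect hγ hL hD (n := n) (by omega) (hW n)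
  have hsmall : L * D / (2 * n) ≤ η := by
    have h1 : L * D / (2 * η) ≤ n := hn₂.trans (Nat.cast_le.2 hn2)
    rw [div_le_iff₀ (by positivity)] at h1 ⊢
    linarith
  have hml : 0 < F.m l := by
    by_contra h
    have h1 := F.gain l
    rw [Nat.eq_zero_of_not_pos h] at h1
    simp only [Finset.range_zero, Finset.sum_empty] at h1
    linarith
  obtain ⟨e, he⟩ : ∃ e : ℝ, e = (1 / 2) ^ n / (1 - 1 / 2) := ⟨_, rfl⟩
  have he0 : 0 ≤ e := by
    rw [he]; exact div_nonneg (by positivity) (by norm_num)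
  have heη : e ≤ η := by
    have h1 : (1 / 2 : ℝ) ^ n ≤ (1 / 2) ^ n₃ :=
      pow_le_pow_of_le_one (by norm_num) (by norm_num) hn3
    rw [he, div_le_iff₀ (by norm_num)]
    linarith
  have hmain := F.V_ge hγ (k := k) (l := l) (n := n) (by omega) (ε := fun j => (1 / 2) ^ j) (e := e)
    (fun j => by positivity)
    (fun m => by rw [he]; exact geom_sum_Ico_le_of_lt_one (by norm_num) (by norm_num))
    (fun j hj => (Nat.cast_le.2 ((hm l).trans (ha hlK))).trans (hcard n j hj)) hml hη0 hη1
    (fun I hI => ⟨y I, hy I, fun c φ ψ h => hdep I c φ ψ fun t ht =>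
      h t ((ht.trans (Finset.le_sup (Finset.mem_range.2 hI))).trans hn1)⟩) (hl.trans hsmall)
  have h1 := hmain.trans (hk l)
  have h2 : ((1 - η) * F.V k - η) / (1 + e) - η + ((1 - η) * δ - 2 * η) / (2 * (1 + e)) =
      ((1 - η) * F.V k - η + ((1 - η) * δ - 2 * η) / 2) / (1 + e) - η := by field_simp; ring
  rw [h2, sub_le_iff_le_add, div_le_iff₀ (by linarith)] at h1
  have hV0 := F.V_nonneg k
  have hVB := F.V_le k
  have h3 : (F.V k + η + η) * (1 + e) ≤ (F.V k + η + η) * (1 + η) := by gcongr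
  have h4 : η * F.V k ≤ η * (L * D) := by gcongr
  have h5 : η * η ≤ η * 1 := by gcongr
  nlinarith

lemma exists_parameters {a : ℕ → ℕ} (ha : Monotone a) : ∃ (N : ℕ → ℕ) (γ : ℕ → ℝ) (W : ℕ → ℕ),
    (∀ j, 1 ≤ γ j) ∧ (∀ j, Real.exp (γ j) * 2 ^ j * 8 ≤ N j) ∧
    (∀ n, (nodes N n).card ≤ W n) ∧ ∀ n j, n ≤ j →
      (a (n + (n * (W n + 1)) ^ 2) : ℝ) ≤ Real.exp (2 * γ j * (1 / 2) ^ j) := by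
  let g : ℕ → ℕ → ℝ := fun n w => 2 ^ n * (a (n + (n * (w + 1)) ^ 2) + 1)
  let b : ℕ → ℕ → ℕ := fun n w => ⌈Real.exp (g n w) * 2 ^ n * 8⌉₊
  let W : ℕ → ℕ := fun n => Nat.rec 0 (fun k w => w + (w + 1) * b k w) n
  have hW : ∀ n, W (n + 1) = W n + (W n + 1) * b n (W n) := fun _ => rfl
  have hmono : Monotone W := monotone_nat_of_le_succ fun n => by rw [hW]; omega
  refine ⟨fun n => b n (W n), fun n => g n (W n), W, fun j => ?_, fun j => Nat.le_ceil _,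
    card_nodes_le hW, fun n j hnj => ?_⟩
  · exact one_le_mul_of_one_le_of_one_le (one_le_pow₀ one_le_two) (by simp)
  · have h1 : a (n + (n * (W n + 1)) ^ 2) ≤ a (j + (j * (W j + 1)) ^ 2) := by
      have := hmono hnj
      apply ha
      gcongr
    have h2 : 2 * g j (W j) * (1 / 2) ^ j = 2 * (a (j + (j * (W j + 1)) ^ 2) + 1) := by
      simp only [g, one_div, inv_pow]
      field_simp
    have h3 := Real.add_one_le_exp (2 * ((a (j + (j * (W j + 1)) ^ 2) : ℝ) + 1))
    have h4 : (a (n + (n * (W n + 1)) ^ 2) : ℝ) ≤ a (j + (j * (W j + 1)) ^ 2) :=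
      Nat.cast_le.2 h1
    have h5 : (0 : ℝ) ≤ a (j + (j * (W j + 1)) ^ 2) := Nat.cast_nonneg _
    rw [h2]
    linarith

section Thick

variable {M : Type}

open Classical in
/-- The curve that follows `g'` on the intervals `[q i, q (i + 1)]` with `i ∈ σ` and `g`
elsewhere. -/
def mix (g g' : ℝ → M) (q : ℕ → ℝ) (σ : Finset ℕ) (t : ℝ) : M :=
  if ∃ i ∈ σ, t ∈ Icc (q i) (q (i + 1)) then g' t else g t

lemma mix_eq_or (g g' : ℝ → M) (q : ℕ → ℝ) (σ : Finset ℕ) (t : ℝ) :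
    mix g g' q σ t = g t ∨ mix g g' q σ t = g' t := by
  unfold mix
  split_ifs <;> simp

lemma mix_of_mem {g g' : ℝ → M} {q : ℕ → ℝ} {σ : Finset ℕ} {i : ℕ} (hi : i ∈ σ) {t : ℝ}
    (ht : t ∈ Icc (q i) (q (i + 1))) : mix g g' q σ t = g' t :=
  if_pos ⟨i, hi, ht⟩

lemma mix_of_eq {g g' : ℝ → M} {q : ℕ → ℝ} {σ : Finset ℕ} {t : ℝ} (h : g' t = g t) :
    mix g g' q σ t = g t := by
  rcases mix_eq_or g g' q σ t with h' | h'
  · exact h'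
  · rw [h', h]

lemma mix_of_notMem {g g' : ℝ → M} {q : ℕ → ℝ} {m : ℕ} (hq : ∀ i < m, q i < q (i + 1))
    (hg : ∀ i ≤ m, g' (q i) = g (q i)) {σ : Finset ℕ} (hσ : σ ⊆ Finset.range m) {i : ℕ}
    (him : i < m) (hi : i ∉ σ) {t : ℝ} (ht : t ∈ Icc (q i) (q (i + 1))) :
    mix g g' q σ t = g t := by
  by_cases h : ∃ j ∈ σ, t ∈ Icc (q j) (q (j + 1))
  · obtain ⟨j, hj, hjt⟩ := h
    have hmono : ∀ a b, a ≤ b → b ≤ m → q a ≤ q b := by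
      intro a b hab
      induction b, hab using Nat.le_induction with
      | base => exact fun _ => le_rfl
      | succ b _ ih => exact fun hb => (ih (by omega)).trans (hq b (by omega)).le
    have hjm : j < m := Finset.mem_range.1 (hσ hj)
    apply mix_of_eq
    rcases lt_trichotomy i j with hij | rfl | hij
    · rw [show t = q j from le_antisymm (ht.2.trans (hmono _ _ hij hjm.le)) hjt.1]
      exact hg j hjm.le
    · exact absurd hj hi
    · rw [show t = q i from le_antisymm (hjt.2.trans (hmono _ _ hij him.le)) ht.1]
      exact hg i him.le
  · exact if_neg h

variable [MetricSpace M] {u v : M} {T : Set (ℝ → M)}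

lemma IsUVGeodesic.mix {g g' : ℝ → M} (hg : IsUVGeodesic u v g) (hg' : IsUVGeodesic u v g')
    {q : ℕ → ℝ} {m : ℕ} (heq : ∀ i ≤ m, g' (q i) = g (q i)) {σ : Finset ℕ}
    (hσ : σ ⊆ Finset.range m) : IsUVGeodesic u v (mix g g' q σ) := by
  have hleft : ∀ t : ℝ, t ≤ 0 → RNPTree.mix g g' q σ t = u := fun t ht => by
    rcases mix_eq_or g g' q σ t with h | h
    · rw [h, hg.left t ht]
    · rw [h, hg'.left t ht]
  have hright : ∀ t : ℝ, dist u v ≤ t → RNPTree.mix g g' q σ t = v := fun t ht => by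
    rcases mix_eq_or g g' q σ t with h | h
    · rw [h, hg.right t ht]
    · rw [h, hg'.right t ht]
  have hu : ∀ {k : ℝ → M}, IsUVGeodesic u v k → ∀ t ∈ Icc 0 (dist u v), dist u (k t) = t := by
    intro k hk t ht
    have := hk.isom 0 ⟨le_rfl, dist_nonneg⟩ t ht
    rwa [hk.left 0 le_rfl, zero_sub, abs_neg, abs_of_nonneg ht.1] at this
  have hv : ∀ {k : ℝ → M}, IsUVGeodesic u v k → ∀ t ∈ Icc 0 (dist u v),
      dist (k t) v = dist u v - t := by
    intro k hk t ht
    have := hk.isom t ht _ ⟨dist_nonneg, le_rfl⟩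
    rwa [hk.right _ le_rfl, abs_sub_comm, abs_of_nonneg (sub_nonneg.2 ht.2)] at this
  have key : ∀ s ∈ Icc (0 : ℝ) (dist u v), ∀ t ∈ Icc (0 : ℝ) (dist u v), s ≤ t →
      dist (RNPTree.mix g g' q σ s) (RNPTree.mix g g' q σ t) = t - s := by
    intro s hs t ht hst
    have hi : ∀ {k : ℝ → M}, IsUVGeodesic u v k → ∀ a ∈ Icc s t, ∀ b ∈ Icc s t, a ≤ b →
        dist (k a) (k b) = b - a := by
      intro k hk a ha b hb hab
      rw [hk.isom a ⟨hs.1.trans ha.1, ha.2.trans ht.2⟩ b ⟨hs.1.trans hb.1, hb.2.trans ht.2⟩,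
        abs_sub_comm, abs_of_nonneg (sub_nonneg.2 hab)]
    have hss : s ∈ Icc s t := ⟨le_rfl, hst⟩
    have htt : t ∈ Icc s t := ⟨hst, le_rfl⟩
    apply le_antisymm
    · by_cases h1 : ∃ i ∈ σ, s ∈ Icc (q i) (q (i + 1)) <;>
        by_cases h2 : ∃ i ∈ σ, t ∈ Icc (q i) (q (i + 1))
      · simp only [RNPTree.mix, if_pos h1, if_pos h2]
        exact (hi hg' s hss t htt hst).le
      · simp only [RNPTree.mix, if_pos h1, if_neg h2]
        obtain ⟨i, hiσ, his⟩ := h1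
        have hit : q (i + 1) ≤ t := by
          by_contra! hc
          exact h2 ⟨i, hiσ, his.1.trans hst, hc.le⟩
        have him := Finset.mem_range.1 (hσ hiσ)
        have hb : q (i + 1) ∈ Icc s t := ⟨his.2, hit⟩
        have h3 := dist_triangle (g' s) (g' (q (i + 1))) (g t)
        rw [hi hg' s hss _ hb hb.1, heq (i + 1) him, hi hg _ hb t htt hb.2] at h3
        linarith
      · simp only [RNPTree.mix, if_neg h1, if_pos h2]
        obtain ⟨i, hiσ, hit⟩ := h2
        have his : s ≤ q i := by
          by_contra! hc
          exact h1 ⟨i, hiσ, hc.le, hst.trans hit.2⟩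
        have him := Finset.mem_range.1 (hσ hiσ)
        have hb : q i ∈ Icc s t := ⟨his, hit.1⟩
        have h3 := dist_triangle (g s) (g (q i)) (g' t)
        rw [hi hg s hss _ hb hb.1, ← heq i him.le, hi hg' _ hb t htt hb.2] at h3
        linarith
      · simp only [RNPTree.mix, if_neg h1, if_neg h2]
        exact (hi hg s hss t htt hst).le
    · have h1 : dist u (RNPTree.mix g g' q σ s) = s := by
        rcases mix_eq_or g g' q σ s with h | h
        · rw [h, hu hg s hs]
        · rw [h, hu hg' s hs]
      have h2 : dist (RNPTree.mix g g' q σ t) v = dist u v - t := by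
        rcases mix_eq_or g g' q σ t with h | h
        · rw [h, hv hg t ht]
        · rw [h, hv hg' t ht]
      have h3 := dist_triangle4 u (RNPTree.mix g g' q σ s) (RNPTree.mix g g' q σ t) v
      linarith
  refine ⟨hleft, hright, fun s hs t ht => ?_⟩
  rcases le_total s t with h | h
  · rw [key s hs t ht h, abs_sub_comm, abs_of_nonneg (sub_nonneg.2 h)]
  · rw [dist_comm, key t ht s hs h, abs_of_nonneg (sub_nonneg.2 h)]

/-- A member of a family of geodesics together with finitely many parameters. -/
structure Stage (u v : M) (T : Set (ℝ → M)) where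
  path : ℝ → M
  path_mem : path ∈ T
  n : ℕ
  p : ℕ → ℝ
  p_mem : ∀ i ≤ n, p i ∈ Icc 0 (dist u v)

/-- A second geodesic meeting the path of a stage at a partition through its parameters, such
that all mixtures of the two geodesics remain in the family. -/
structure Fork (α : ℝ) (x : Stage u v T) where
  other : ℝ → M
  m : ℕ
  q : ℕ → ℝ
  s : ℕ → ℝ
  q_zero : q 0 = 0
  q_last : q m = dist u v
  q_lt : ∀ i < m, q i < s i
  s_lt : ∀ i < m, s i < q (i + 1)
  other_eq : ∀ i ≤ m, other (q i) = x.path (q i)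
  refines : ∀ i ≤ x.n, ∃ j ≤ m, q j = x.p i
  wide : α ≤ ∑ i ∈ Finset.range m, dist (x.path (s i)) (other (s i))
  mix_mem : ∀ σ ⊆ Finset.range m, mix x.path other q σ ∈ T

lemma IsThickFamily.exists_fork (hT : IsThickFamily u v T) :
    ∃ α : ℝ, 0 < α ∧ ∀ x : Stage u v T, Nonempty (Fork α x) := by
  obtain ⟨-, hgeo, α, hα, hthick⟩ := hT
  refine ⟨α, hα, fun x => ?_⟩
  obtain ⟨g', hg', m, q, s, hq, hq0, hqm, hs, heq, href, hwide, hmix⟩ :=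
    hthick x.path x.path_mem (x.n + 1) (fun i => x.p i)
      fun i => x.p_mem i (Nat.lt_succ_iff.1 i.2)
  set q' : ℕ → ℝ := fun i => if h : i < m + 1 then q ⟨i, h⟩ else 0
  set s' : ℕ → ℝ := fun i => if h : i < m then s ⟨i, h⟩ else 0
  have hq' : ∀ i (h : i < m + 1), q' i = q ⟨i, h⟩ := fun i h => dif_pos h
  have hs' : ∀ i (h : i < m), s' i = s ⟨i, h⟩ := fun i h => dif_pos h
  have hlt : ∀ i < m, q' i < s' i := fun i hi => by
    rw [hq' i (by omega), hs' i hi]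
    exact (hs ⟨i, hi⟩).1
  have hgt : ∀ i < m, s' i < q' (i + 1) := fun i hi => by
    rw [hq' (i + 1) (by omega), hs' i hi]
    exact (hs ⟨i, hi⟩).2
  have heq' : ∀ i ≤ m, g' (q' i) = x.path (q' i) := fun i hi => by
    rw [hq' i (by omega)]
    exact (heq _).symm
  have hgx := hgeo _ x.path_mem
  refine ⟨⟨g', m, q', s', ?_, ?_, hlt, hgt, heq', fun i hi => ?_, ?_, fun σ hσ => ?_⟩⟩
  · rw [hq' 0 (by omega)]
    exact hq0
  · rw [hq' m (by omega)]
    exact hqm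
  · obtain ⟨j, hj⟩ := href ⟨i, by omega⟩
    refine ⟨j, by omega, ?_⟩
    rw [hq' j j.2]
    have hmem : q j ∈ Icc 0 (dist u v) :=
      ⟨hq0 ▸ hq.monotone (Fin.zero_le j), hqm ▸ hq.monotone (Fin.le_last j)⟩
    have h1 := hgx.isom _ (x.p_mem i hi) _ hmem
    have h2 : x.path (x.p i) = x.path (q j) := hj
    rw [h2, dist_self, eq_comm, abs_eq_zero, sub_eq_zero] at h1
    exact h1.symm
  · rw [Finset.sum_range]
    refine hwide.trans_eq (Finset.sum_congr rfl fun i _ => ?_)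
    rw [hs' i i.2]
  · refine hmix _ (IsUVGeodesic.mix hgx (hgeo _ hg') heq' hσ) fun i => ?_
    have h1 : q i.castSucc = q' i := (hq' i (by omega)).symm
    have h2 : q i.succ = q' (i + 1) := (hq' (i + 1) (by omega)).symm
    rw [h1, h2]
    by_cases hi : (i : ℕ) ∈ σ
    · exact Or.inr fun t ht => mix_of_mem hi ht
    · exact Or.inl fun t ht =>
        mix_of_notMem (fun j hj => (hlt j hj).trans (hgt j hj)) heq' hσ i.2 hi ht

/-- The sequence `q 0, s 0, q 1, s 1, …`. -/
def interleave (q s : ℕ → ℝ) (i : ℕ) : ℝ :=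
  if i % 2 = 0 then q (i / 2) else s (i / 2)

lemma interleave_even (q s : ℕ → ℝ) (i : ℕ) : interleave q s (2 * i) = q i := by
  simp [interleave]

lemma interleave_odd (q s : ℕ → ℝ) (i : ℕ) : interleave q s (2 * i + 1) = s i := by
  simp [interleave, Nat.add_mod, show (2 * i + 1) / 2 = i by omega]

namespace Fork

variable {α : ℝ} {x : Stage u v T} (F : Fork α x)

lemma q_mem : ∀ i ≤ F.m, F.q i ∈ Icc 0 (dist u v) := by
  have hmono : ∀ a b, a ≤ b → b ≤ F.m → F.q a ≤ F.q b := by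
    intro a b hab
    induction b, hab using Nat.le_induction with
    | base => exact fun _ => le_rfl
    | succ b _ ih =>
      exact fun hb => (ih (by omega)).trans ((F.q_lt b hb).trans (F.s_lt b hb)).le
  exact fun i hi => ⟨F.q_zero ▸ hmono 0 i (Nat.zero_le _) hi, F.q_last ▸ hmono i _ hi le_rfl⟩

/-- Pass to the mixture given by `σ` and record all points of the fork. -/
def next (σ : Finset ℕ) : Stage u v T where
  path := mix x.path F.other F.q (σ ∩ Finset.range F.m)
  path_mem := F.mix_mem _ Finset.inter_subset_right
  n := 2 * F.m
  p := interleave F.q F.s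
  p_mem i hi := by
    rcases Nat.even_or_odd' i with ⟨j, rfl | rfl⟩
    · rw [interleave_even]
      exact F.q_mem j (by omega)
    · rw [interleave_odd]
      exact ⟨(F.q_mem j (by omega)).1.trans (F.q_lt j (by omega)).le,
        (F.s_lt j (by omega)).le.trans (F.q_mem (j + 1) (by omega)).2⟩

lemma next_path_q (σ : Finset ℕ) {i : ℕ} (hi : i ≤ F.m) :
    (F.next σ).path (F.q i) = x.path (F.q i) :=
  mix_of_eq (F.other_eq i hi)

open Classical in
lemma next_path_s (σ : Finset ℕ) {i : ℕ} (hi : i < F.m) :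
    (F.next σ).path (F.s i) = if i ∈ σ then F.other (F.s i) else x.path (F.s i) := by
  have hs : F.s i ∈ Icc (F.q i) (F.q (i + 1)) := ⟨(F.q_lt i hi).le, (F.s_lt i hi).le⟩
  split_ifs with h
  · exact mix_of_mem (Finset.mem_inter.2 ⟨h, Finset.mem_range.2 hi⟩) hs
  · exact mix_of_notMem (fun j hj => (F.q_lt j hj).trans (F.s_lt j hj)) F.other_eq
      Finset.inter_subset_right hi (fun h' => h (Finset.mem_inter.1 h').1) hs

lemma exists_gain {X : Type*} [NormedAddCommGroup X] [NormedSpace ℝ X] {f : M → X} {l : ℝ}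
    (hf : ∀ y z, l * dist y z ≤ ‖f y - f z‖) (F : Fork α x) (hl : 0 < l) :
    ∃ σ ⊆ Finset.range F.m, l * α / 2 ≤ ∑ i ∈ Finset.range F.m,
      ‖f ((F.next σ).path (F.s i)) - f ((F.next σ).path (F.q i)) -
        ((F.s i - F.q i) / (F.q (i + 1) - F.q i)) •
          (f ((F.next σ).path (F.q (i + 1))) - f ((F.next σ).path (F.q i)))‖ := by
  classical
  set c : ℕ → X := fun i => f (x.path (F.q i)) + ((F.s i - F.q i) / (F.q (i + 1) - F.q i)) •
    (f (x.path (F.q (i + 1))) - f (x.path (F.q i))) with hc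
  set A : ℕ → ℝ := fun i => ‖f (x.path (F.s i)) - c i‖
  set B : ℕ → ℝ := fun i => ‖f (F.other (F.s i)) - c i‖
  refine ⟨(Finset.range F.m).filter fun i => A i < B i, Finset.filter_subset _ _, ?_⟩
  calc l * α / 2
      ≤ l * (∑ i ∈ Finset.range F.m, dist (x.path (F.s i)) (F.other (F.s i))) / 2 := by
        have := F.wide
        gcongr
    _ = ∑ i ∈ Finset.range F.m, l * dist (x.path (F.s i)) (F.other (F.s i)) / 2 := by
        rw [Finset.mul_sum, Finset.sum_div]
    _ ≤ _ := Finset.sum_le_sum fun i hi => ?_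
  have him := Finset.mem_range.1 hi
  have h1 := (hf (x.path (F.s i)) (F.other (F.s i))).trans
    (norm_sub_le_norm_sub_add_norm_sub _ (c i) _)
  rw [norm_sub_rev (c i)] at h1
  change _ ≤ A i + B i at h1
  rw [F.next_path_q _ him.le, F.next_path_q _ (i := i + 1) him, F.next_path_s _ him, sub_sub]
  split_ifs with h
  · have h2 := (Finset.mem_filter.1 h).2
    change _ ≤ B i
    linarith
  · have h2 : B i ≤ A i := not_lt.1 fun h3 => h (Finset.mem_filter.2 ⟨hi, h3⟩)
    change _ ≤ A i
    linarith

end Fork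

/-- In a process with finitely many choices at every step, all quantities are bounded by a
function of the number of steps. -/
lemma exists_monotone_bound {S : Type*} (w : S → ℕ) (step : S → Finset ℕ → S) (x₀ : S) :
    ∃ a : ℕ → ℕ, Monotone a ∧ ∀ x : ℕ → S, x 0 = x₀ →
      (∀ k, ∃ σ ⊆ Finset.range (w (x k)), x (k + 1) = step (x k) σ) → ∀ k, w (x k) ≤ a k := by
  classical
  let R : ℕ → Finset S := fun k => Nat.rec {x₀}
    (fun _ A => A.biUnion fun y => (Finset.range (w y)).powerset.image (step y)) k
  refine ⟨fun k => ∑ j ∈ Finset.range (k + 1), ∑ y ∈ R j, w y, fun k l hkl => ?_,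
    fun x hx0 hx k => ?_⟩
  · exact Finset.sum_le_sum_of_subset (Finset.range_mono (by omega))
  · have hR : ∀ k, x k ∈ R k := by
      intro k
      induction k with
      | zero => exact Finset.mem_singleton.2 hx0
      | succ k ih =>
        obtain ⟨σ, hσ, h⟩ := hx k
        exact Finset.mem_biUnion.2 ⟨_, ih, Finset.mem_image.2
          ⟨σ, Finset.mem_powerset.2 hσ, h.symm⟩⟩
    calc w (x k) ≤ ∑ y ∈ R k, w y := Finset.single_le_sum (fun _ _ => Nat.zero_le _) (hR k)
      _ ≤ _ := Finset.single_le_sum (f := fun j => ∑ y ∈ R j, w y) (fun _ _ => Nat.zero_le _)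
          (Finset.self_mem_range_succ k)

/-- A thick family yields, with partition sizes bounded independently of the target, a ladder in
every normed space that receives a bilipschitz copy of the metric space. -/
lemma IsThickFamily.exists_ladder (hT : IsThickFamily u v T) :
    ∃ a : ℕ → ℕ, Monotone a ∧ ∃ α : ℝ, 0 < α ∧
      ∀ (X : Type) [NormedAddCommGroup X] [NormedSpace ℝ X] (f : M → X) (l L : ℝ), 0 < l →
        0 ≤ L → (∀ y z, l * dist y z ≤ ‖f y - f z‖ ∧ ‖f y - f z‖ ≤ L * dist y z) →
        ∃ F : Ladder X (dist u v) L (l * α / 2), ∀ k, F.m k ≤ a k := by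
  obtain ⟨α, hα, hfork⟩ := IsThickFamily.exists_fork hT
  let F : ∀ x : Stage u v T, Fork α x := fun x => (hfork x).some
  obtain ⟨g₀, hg₀⟩ := hT.1
  let x₀ : Stage u v T := ⟨g₀, hg₀, 0, fun _ => 0, fun _ _ => ⟨le_rfl, dist_nonneg⟩⟩
  obtain ⟨a, ha, hbound⟩ := exists_monotone_bound (fun x => (F x).m) (fun x => (F x).next) x₀
  refine ⟨a, ha, α, hα, fun X _ _ f l L hl hL hf => ?_⟩
  choose σ hσ hgain using fun x => (F x).exists_gain (fun y z => (hf y z).1) hl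
  let st : ℕ → Stage u v T := fun k => Nat.rec x₀ (fun _ x => (F x).next (σ x)) k
  refine ⟨{ m := fun k => (F (st k)).m
            Q := fun k => (F (st k)).q
            S := fun k => (F (st k)).s
            G := fun k t => f ((st (k + 1)).path t)
            Q_zero := fun k => (F (st k)).q_zero
            Q_last := fun k => (F (st k)).q_last
            Q_lt := fun k => (F (st k)).q_lt
            S_lt := fun k => (F (st k)).s_lt
            lip := fun k s hs t ht => ?_
            matchQ := fun k i hi => ?_
            matchS := fun k i hi => ?_
            agree := fun k j hj => ?_
            gain := fun k => hgain (st k) }, fun k => ?_⟩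
  · rw [← (hT.2.1 _ (st (k + 1)).path_mem).isom t ht s hs]
    exact (hf _ _).2
  · obtain ⟨j, hj, h⟩ := (F (st (k + 1))).refines (2 * i) (Nat.mul_le_mul_left 2 hi)
    exact ⟨j, hj, h.trans (interleave_even _ _ i)⟩
  · obtain ⟨j, hj, h⟩ := (F (st (k + 1))).refines (2 * i + 1)
      (show 2 * i + 1 ≤ 2 * (F (st k)).m by omega)
    exact ⟨j, hj, h.trans (interleave_odd _ _ i)⟩
  · exact congrArg f ((F (st (k + 1))).next_path_q (σ (st (k + 1))) hj)
  · exact hbound st rfl (fun k => ⟨σ (st k), hσ (st k), rfl⟩) k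

end Thick

end RNPTree

/-- For every metric space `M` with a thick family of geodesics there is a Banach space
failing the Radon–Nikodým property into which `M` does not embed bilipschitzly. -/
theorem thick_family_not_universal_for_RNP
    (M : Type) [MetricSpace M] (u v : M) (T : Set (ℝ → M)) (hT : IsThickFamily u v T) :
    ∃ (X : Type) (_ : NormedAddCommGroup X) (_ : NormedSpace ℝ X) (_ : CompleteSpace X),
      HasBoundedDivergentMartingale X ∧
      ¬ ∃ (f : M → X) (l L : ℝ), 0 < l ∧ l ≤ L ∧
          ∀ x y : M, l * dist x y ≤ ‖f x - f y‖ ∧ ‖f x - f y‖ ≤ L * dist x y := by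
  obtain ⟨a, ha, α, hα, hladder⟩ := RNPTree.IsThickFamily.exists_ladder hT
  obtain ⟨N, γ, W, hγ, hN, hW, hcard⟩ := RNPTree.exists_parameters ha
  refine ⟨RNPTree.TreeSpace N γ, inferInstance, inferInstance, inferInstance,
    RNPTree.hasBoundedDivergentMartingale_treeSpace hγ hN, ?_⟩
  rintro ⟨f, l, L, hl, hlL, hf⟩
  have hL : 0 ≤ L := hl.le.trans hlL
  obtain ⟨F, hF⟩ := hladder _ f l L hl hL hf
  exact F.false_of_le (fun j => zero_le_one.trans (hγ j)) (by positivity) hL dist_nonneg hW ha hF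
    hcard
end
end

section
/- Fix Δ ≥ 2. A Banach space X is not reflexive if and only if there exist a constant 1 ≤ C < ∞ and a map f : ℓ₁ → X such that for every pair x, y ∈ ℓ₁ satisfying ‖x − y‖₁ ≤ Δ·‖x − y‖_s one has ‖x − y‖₁ ≤ ‖f(x) − f(y)‖ ≤ C·‖x − y‖₁. -/
noncomputable section

/-- The summing norm `‖x‖ₛ = sup_k |∑_{i<k} x_i|` on `ℓ₁`. -/
def summingNorm (x : lp (fun _ : ℕ => ℝ) 1) : ℝ :=
  ⨆ k : ℕ, |∑ i ∈ Finset.range k, x i|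

/-- A Banach space is reflexive if the canonical embedding into the double dual is
surjective. -/
def IsReflexiveBanach (X : Type) [NormedAddCommGroup X] [NormedSpace ℝ X] : Prop :=
  Function.Surjective (NormedSpace.inclusionInDoubleDual ℝ X)

open Filter Topology MeasureTheory Set
open scoped NNReal ENNReal

/-- The Banach space `ℓ₁` of absolutely summable real sequences. -/
abbrev EllOne : Type := lp (fun _ : ℕ => ℝ) 1

theorem EllOne.summable_abs (a : EllOne) : Summable fun i => |a i| := by
  have := (lp.memℓp a).summable (by simp)
  simpa using this

theorem EllOne.norm_eq_tsum (a : EllOne) : ‖a‖ = ∑' i, |a i| := by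
  rw [lp.norm_eq_tsum_rpow (by simp) a]
  simp

theorem EllOne.sum_abs_le_norm (a : EllOne) (s : Finset ℕ) : ∑ i ∈ s, |a i| ≤ ‖a‖ := by
  rw [a.norm_eq_tsum]
  exact a.summable_abs.sum_le_tsum _ fun _ _ => abs_nonneg _

theorem abs_sum_range_le_norm (a : EllOne) (k : ℕ) :
    |∑ i ∈ Finset.range k, a i| ≤ ‖a‖ :=
  (Finset.abs_sum_le_sum_abs _ _).trans (a.sum_abs_le_norm _)

theorem abs_sum_range_le_summingNorm (a : EllOne) (k : ℕ) :
    |∑ i ∈ Finset.range k, a i| ≤ summingNorm a :=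
  le_ciSup (f := fun k => |∑ i ∈ Finset.range k, a i|)
    ⟨‖a‖, by rintro _ ⟨k, rfl⟩; exact abs_sum_range_le_norm a k⟩ k

theorem summingNorm_nonneg (a : EllOne) : 0 ≤ summingNorm a := by
  simpa using abs_sum_range_le_summingNorm a 0

section Nonreflexive

variable {X : Type} [NormedAddCommGroup X] [NormedSpace ℝ X]

/-- If a functional `F` on the dual of `X` is at distance at least `θ` from the canonical image of
`X`, then it takes the value `θ` at some norm-one-bounded functional vanishing at finitely many
prescribed points. -/
theorem exists_functional_vanishing_on_finset
    {F : StrongDual ℝ (StrongDual ℝ X)} {θ : ℝ} (hθ : 0 < θ)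
    (hF : ∀ x, θ < ‖F - NormedSpace.inclusionInDoubleDual ℝ X x‖) (s : Finset X) :
    ∃ g : StrongDual ℝ X, ‖g‖ ≤ 1 ∧ F g = θ ∧ ∀ x ∈ s, g x = 0 := by
  set N : Subspace ℝ (StrongDual ℝ X) :=
    ⨅ x : s, LinearMap.ker (NormedSpace.inclusionInDoubleDual ℝ X x : StrongDual ℝ X →ₗ[ℝ] ℝ)
    with hN
  have hmem : ∀ g : StrongDual ℝ X, g ∈ N ↔ ∀ x ∈ s, g x = 0 := by
    intro g
    simp [hN, Submodule.mem_iInf]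
  have key : ∃ g ∈ N, ‖g‖ ≤ 1 ∧ θ < ‖F g‖ := by
    by_contra! hcon
    obtain ⟨G, hG, hGn⟩ := exists_extension_norm_eq N (F.comp N.subtypeL)
    have hGle : ‖G‖ ≤ θ := by
      rw [hGn]
      refine ContinuousLinearMap.opNorm_le_of_unit_norm hθ.le fun g hg => ?_
      exact hcon g g.2 (le_of_eq hg)
    have hspan : ((F - G : StrongDual ℝ (StrongDual ℝ X)) : StrongDual ℝ X →ₗ[ℝ] ℝ) ∈
        Submodule.span ℝ (Set.range fun x : s =>
          (NormedSpace.inclusionInDoubleDual ℝ X x : StrongDual ℝ X →ₗ[ℝ] ℝ)) := by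
      refine mem_span_of_iInf_ker_le_ker fun g hg => ?_
      have := hG ⟨g, hg⟩
      simp at this
      simp [this]
    rw [Submodule.mem_span_range_iff_exists_fun] at hspan
    obtain ⟨c, hc⟩ := hspan
    have hx : F - NormedSpace.inclusionInDoubleDual ℝ X (∑ i, c i • (i : X)) = G := by
      ext g
      have := DFunLike.congr_fun hc g
      simp at this
      simp [this]
    exact absurd (hF (∑ i, c i • (i : X))) (by rw [hx]; exact hGle.not_gt)
  obtain ⟨g, hgN, hg1, hg⟩ := key
  have hFg : F g ≠ 0 := by
    intro h
    rw [h, norm_zero] at hg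
    linarith
  refine ⟨(θ / F g) • g, ?_, ?_, ?_⟩
  · rw [norm_smul, norm_div, Real.norm_of_nonneg hθ.le]
    have : θ / ‖F g‖ ≤ 1 := (div_le_one (hθ.trans hg)).2 hg.le
    exact mul_le_one₀ this (norm_nonneg _) hg1
  · simp [hFg]
  · intro x hx
    simp [(hmem g).1 hgN x hx]

/-- Helly's theorem: an element of the unit ball of the double dual is approximated, on finitely
many functionals, by an element of the unit ball. -/
theorem exists_approx_of_mem_doubleDual
    {F : StrongDual ℝ (StrongDual ℝ X)} (hF : ‖F‖ ≤ 1) (s : Finset (StrongDual ℝ X))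
    {ε : ℝ} (hε : 0 < ε) :
    ∃ x : X, ‖x‖ ≤ 1 ∧ ∀ g ∈ s, |g x - F g| ≤ ε := by
  classical
  let A : X →L[ℝ] (s → ℝ) := ContinuousLinearMap.pi fun g => (g : StrongDual ℝ X)
  let b : s → ℝ := fun g => F g
  have hb : b ∈ closure (A '' Metric.closedBall 0 1) := by
    by_contra hb
    obtain ⟨φ, u, h1, h2⟩ := geometric_hahn_banach_closed_point
      (((convex_closedBall (0 : X) 1).linear_image A.toLinearMap).closure) isClosed_closure hb
    have hφ : ∀ v : s → ℝ, φ v = ∑ g, v g * φ (Pi.single g 1) := by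
      intro v
      conv_lhs => rw [← Finset.univ_sum_single v]
      rw [map_sum]
      refine Finset.sum_congr rfl fun g _ => ?_
      rw [← smul_eq_mul, ← map_smul, ← Pi.single_smul]
      simp
    let G : StrongDual ℝ X := ∑ g : s, φ (Pi.single g 1) • (g : StrongDual ℝ X)
    have hGx : ∀ x, φ (A x) = G x := by
      intro x
      rw [hφ]
      simp [G, A, mul_comm]
    have hGb : φ b = F G := by
      rw [hφ]
      simp [G, b, mul_comm]
    have hlt : ∀ x, ‖x‖ ≤ 1 → G x < u := fun x hx => by
      rw [← hGx]
      exact h1 _ (subset_closure ⟨x, by simpa using hx, rfl⟩)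
    have hu : 0 < u := by simpa using hlt 0 (by simp)
    have hG : ‖G‖ ≤ u := by
      refine ContinuousLinearMap.opNorm_le_of_unit_norm hu.le fun x hx => ?_
      rw [Real.norm_eq_abs, abs_le]
      have := hlt (-x) (by simp [hx])
      rw [map_neg] at this
      exact ⟨by linarith, (hlt x hx.le).le⟩
    have : F G ≤ u := calc
      F G ≤ ‖F G‖ := le_abs_self _
      _ ≤ ‖F‖ * ‖G‖ := F.le_opNorm G
      _ ≤ 1 * u := by gcongr
      _ = u := one_mul u
    rw [hGb] at h2
    linarith
  obtain ⟨_, ⟨x, hx, rfl⟩, hd⟩ := Metric.mem_closure_iff.1 hb ε hε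
  refine ⟨x, by simpa using hx, fun g hg => ?_⟩
  have := (dist_pi_lt_iff hε).1 hd ⟨g, hg⟩
  rw [dist_comm, Real.dist_eq] at this
  exact this.le

/-- If an isometric copy of a Banach space is a proper subspace, some vector of the unit ball is
uniformly far from it. -/
theorem LinearIsometry.exists_far_from_range [CompleteSpace X] {Y : Type*} [NormedAddCommGroup Y]
    [NormedSpace ℝ Y] (J : X →ₗᵢ[ℝ] Y) (h : ¬ Function.Surjective J) :
    ∃ y : Y, ∃ θ : ℝ, 0 < θ ∧ ‖y‖ ≤ 1 ∧ ∀ x, θ < ‖y - J x‖ := by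
  have hR : IsClosed (LinearMap.range J.toLinearMap : Set Y) := by
    have := J.isometry.isUniformInducing.isComplete_range.isClosed
    rwa [LinearMap.coe_range]
  obtain ⟨y₀, hy₀⟩ := not_forall.1 h
  have hy₀R : y₀ ∉ LinearMap.range J.toLinearMap := hy₀
  obtain ⟨y, hy, hfar⟩ := riesz_lemma hR ⟨y₀, hy₀R⟩ (r := 1 / 2) (by norm_num)
  have hpos : 0 < ‖y‖ := by
    rw [norm_pos_iff]
    rintro rfl
    exact hy (Submodule.zero_mem _)
  refine ⟨‖y‖⁻¹ • y, 1 / 4, by norm_num, ?_, fun x => ?_⟩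
  · rw [norm_smul, norm_inv, norm_norm, inv_mul_cancel₀ hpos.ne']
  · have h1 := hfar (J (‖y‖ • x)) ⟨_, rfl⟩
    have h2 : y - J (‖y‖ • x) = ‖y‖ • (‖y‖⁻¹ • y - J x) := by
      rw [smul_sub, smul_smul, mul_inv_cancel₀ hpos.ne', one_smul, map_smul]
    rw [h2, norm_smul, norm_norm] at h1
    nlinarith

/-- A nonreflexive space admits a functional on its dual which is uniformly far from the canonical
image of the space. -/
theorem exists_far_from_inclusionInDoubleDual [CompleteSpace X] (h : ¬ IsReflexiveBanach X) :
    ∃ F : StrongDual ℝ (StrongDual ℝ X), ∃ θ : ℝ, 0 < θ ∧ ‖F‖ ≤ 1 ∧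
      ∀ x, θ < ‖F - NormedSpace.inclusionInDoubleDual ℝ X x‖ := by
  unfold IsReflexiveBanach at h
  obtain ⟨F, θ, hθ, hF, hfar⟩ := LinearIsometry.exists_far_from_range
    (Y := StrongDual ℝ (StrongDual ℝ X)) (NormedSpace.inclusionInDoubleDualLi ℝ) h
  refine ⟨F, θ, hθ, hF, fun x => ?_⟩
  have hx : NormedSpace.inclusionInDoubleDual ℝ X x =
    NormedSpace.inclusionInDoubleDualLi ℝ x := rfl
  rw [hx]
  exact hfar x

/-- James' theorem: a nonreflexive space contains, up to arbitrarily small errors, a wide-(s)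
sequence in its unit ball together with functionals biorthogonal to it in the triangular sense. -/
theorem exists_james_sequence [CompleteSpace X] (h : ¬ IsReflexiveBanach X) :
    ∃ θ : ℝ, 0 < θ ∧ ∀ ε > 0, ∃ (x : ℕ → X) (g : ℕ → StrongDual ℝ X),
      (∀ n, ‖x n‖ ≤ 1) ∧ (∀ n, ‖g n‖ ≤ 1) ∧ (∀ i n, i < n → g n (x i) = 0) ∧
      ∀ i n, n ≤ i → |g n (x i) - θ| ≤ ε := by
  classical
  obtain ⟨F, θ, hθ, hF1, hF⟩ := exists_far_from_inclusionInDoubleDual h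
  refine ⟨θ, hθ, fun ε hε => ?_⟩
  obtain ⟨p, hP, hr⟩ := exists_seq_of_forall_finset_exists
    (fun p : X × StrongDual ℝ X => ‖p.1‖ ≤ 1 ∧ ‖p.2‖ ≤ 1 ∧ F p.2 = θ ∧ |p.2 p.1 - θ| ≤ ε)
    (fun p q => q.2 p.1 = 0 ∧ |p.2 q.1 - θ| ≤ ε) (by
      intro s hs
      obtain ⟨g, hg1, hg2, hg3⟩ := exists_functional_vanishing_on_finset hθ hF (s.image Prod.fst)
      obtain ⟨x, hx1, hx2⟩ := exists_approx_of_mem_doubleDual hF1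
        (insert g (s.image Prod.snd)) hε
      refine ⟨(x, g), ⟨hx1, hg1, hg2, ?_⟩, fun q hq => ⟨?_, ?_⟩⟩
      · simpa [hg2] using hx2 g (by simp)
      · exact hg3 _ (Finset.mem_image_of_mem _ hq)
      · have := hx2 q.2 (by simp only [Finset.mem_insert]; exact .inr (Finset.mem_image_of_mem _ hq))
        rwa [(hs q hq).2.2.1] at this)
  refine ⟨fun n => (p n).1, fun n => (p n).2, fun n => (hP n).1, fun n => (hP n).2.1,
    fun i n hin => (hr i n hin).1, fun i n hni => ?_⟩
  rcases hni.eq_or_lt with rfl | hlt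
  · exact (hP n).2.2.2
  · exact (hr n i hlt).2

theorem summable_smul_of_norm_le_one [CompleteSpace X] {x : ℕ → X} (hx : ∀ n, ‖x n‖ ≤ 1)
    (a : EllOne) : Summable fun i => a i • x i := by
  refine Summable.of_norm_bounded a.summable_abs fun i => ?_
  rw [norm_smul, Real.norm_eq_abs]
  exact mul_le_of_le_one_right (abs_nonneg _) (hx i)

theorem norm_tsum_smul_le [CompleteSpace X] {x : ℕ → X} (hx : ∀ n, ‖x n‖ ≤ 1) (a : EllOne) :
    ‖∑' i, a i • x i‖ ≤ ‖a‖ := by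
  rw [a.norm_eq_tsum]
  refine tsum_of_norm_bounded a.summable_abs.hasSum fun i => ?_
  rw [norm_smul, Real.norm_eq_abs]
  exact mul_le_of_le_one_right (abs_nonneg _) (hx i)

/-- The lower estimate for the summing norm furnished by a triangular system. -/
theorem mul_summingNorm_le [CompleteSpace X] {θ ε : ℝ} (hθ : 0 < θ) {x : ℕ → X}
    {g : ℕ → StrongDual ℝ X} (hx : ∀ n, ‖x n‖ ≤ 1) (hg : ∀ n, ‖g n‖ ≤ 1)
    (hzero : ∀ i n, i < n → g n (x i) = 0) (happ : ∀ i n, n ≤ i → |g n (x i) - θ| ≤ ε)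
    (a : EllOne) :
    θ * summingNorm a ≤ 2 * ‖∑' i, a i • x i‖ + 2 * ε * ‖a‖ := by
  set S := ∑' i, a i • x i with hS
  have hgS : ∀ n, |g n S| ≤ ‖S‖ := fun n => by
    have := (g n).le_of_opNorm_le (hg n) S
    simpa using this
  have hsum := summable_smul_of_norm_le_one hx a
  have hval : ∀ n, g n S = ∑' i, a i * g n (x i) := fun n => by
    rw [hS, (g n).map_tsum hsum]
    simp
  have hs : ∀ n, Summable fun i => a i * g n (x i) := fun n => by
    simpa using (g n).summable hsum
  have ha : Summable fun i => a i := a.summable_abs.of_abs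
  have hind : ∀ n, Summable fun i => θ * (if n ≤ i then a i else 0) := fun n => by
    refine Summable.mul_left _ (Summable.of_norm_bounded a.summable_abs fun i => ?_)
    split_ifs <;> simp
  have herr : ∀ n, |g n S - ∑' i, θ * (if n ≤ i then a i else 0)| ≤ ε * ‖a‖ := fun n => by
    rw [hval, ← (hs n).tsum_sub (hind n), a.norm_eq_tsum, ← tsum_mul_left, ← Real.norm_eq_abs]
    refine tsum_of_norm_bounded (a.summable_abs.mul_left ε).hasSum fun i => ?_
    have hε : 0 ≤ ε := (abs_nonneg _).trans (happ 0 0 le_rfl)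
    split_ifs with hi
    · rw [mul_comm θ, ← mul_sub, norm_mul, mul_comm, Real.norm_eq_abs, Real.norm_eq_abs]
      exact mul_le_mul_of_nonneg_right (happ i n hi) (abs_nonneg _)
    · rw [hzero i n (not_le.1 hi)]
      simpa using mul_nonneg hε (abs_nonneg _)
  have htail : ∀ n, θ * ∑ i ∈ Finset.range n, a i =
      (∑' i, θ * (if 0 ≤ i then a i else 0)) - ∑' i, θ * (if n ≤ i then a i else 0) := fun n => by
    rw [← (hind 0).tsum_sub (hind n), Finset.mul_sum,
      tsum_eq_sum (s := Finset.range n) (fun i hi => by simp at hi; simp [hi])]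
    refine Finset.sum_congr rfl fun i hi => ?_
    simp [not_le.2 (Finset.mem_range.1 hi)]
  rw [summingNorm, Real.mul_iSup_of_nonneg hθ.le]
  refine ciSup_le fun n => ?_
  have habs : θ * |∑ i ∈ Finset.range n, a i| = |θ * ∑ i ∈ Finset.range n, a i| := by
    rw [abs_mul, abs_of_pos hθ]
  rw [habs, htail]
  have h0 := abs_le.1 (herr 0)
  have h1 := abs_le.1 (herr n)
  have h2 := abs_le.1 (hgS 0)
  have h3 := abs_le.1 (hgS n)
  rw [abs_le]
  constructor <;> linarith

theorem exists_partial_bilipschitz_of_not_reflexive [CompleteSpace X] {Δ : ℝ} (hΔ : 2 ≤ Δ)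
    (h : ¬ IsReflexiveBanach X) :
    ∃ C : ℝ, 1 ≤ C ∧ ∃ f : EllOne → X, ∀ x y : EllOne, ‖x - y‖ ≤ Δ * summingNorm (x - y) →
      ‖x - y‖ ≤ ‖f x - f y‖ ∧ ‖f x - f y‖ ≤ C * ‖x - y‖ := by
  obtain ⟨θ, hθ, H⟩ := exists_james_sequence h
  obtain ⟨x, g, hx, hg, hzero, happ⟩ := H (θ / (4 * Δ)) (by positivity)
  set c : ℝ := 4 * Δ / θ with hc
  have hcpos : 0 < c := by positivity
  refine ⟨max 1 c, le_max_left _ _, fun a => c • ∑' i, a i • x i, fun a b hab => ?_⟩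
  have hsub : c • ∑' i, a i • x i - c • ∑' i, b i • x i = c • ∑' i, (a - b) i • x i := by
    rw [← smul_sub, ← (summable_smul_of_norm_le_one hx a).tsum_sub
      (summable_smul_of_norm_le_one hx b)]
    simp [sub_smul]
  simp only [hsub]
  rw [norm_smul, Real.norm_of_nonneg hcpos.le]
  have h1 := mul_summingNorm_le hθ hx hg hzero happ (a - b)
  have h2 := norm_tsum_smul_le hx (a - b)
  refine ⟨?_, mul_le_mul (le_max_right _ _) h2 (norm_nonneg _) (by positivity)⟩
  have h3 : 2 * (θ / (4 * Δ)) * ‖a - b‖ ≤ θ / 2 * summingNorm (a - b) := by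
    calc 2 * (θ / (4 * Δ)) * ‖a - b‖ ≤ 2 * (θ / (4 * Δ)) * (Δ * summingNorm (a - b)) := by gcongr
      _ = θ / 2 * summingNorm (a - b) := by field_simp; ring
  rw [hc, div_mul_eq_mul_div, le_div_iff₀ hθ]
  nlinarith

end Nonreflexive

section WeakLimits

variable {X : Type} [NormedAddCommGroup X] [NormedSpace ℝ X]

/-- In a reflexive space, bounded families have weak limits along ultrafilters. -/
theorem IsReflexiveBanach.exists_weak_limit (hX : IsReflexiveBanach X) {ι : Type*}
    (l : Ultrafilter ι) {u : ι → X} {M : ℝ} (hu : ∀ i, ‖u i‖ ≤ M) :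
    ∃ z : X, ∀ φ : StrongDual ℝ X, Tendsto (fun i => φ (u i)) l (𝓝 (φ z)) := by
  have hlim : ∀ φ : StrongDual ℝ X, ∃ c : ℝ, ‖c‖ ≤ M * ‖φ‖ ∧
      Tendsto (fun i => φ (u i)) l (𝓝 c) := fun φ => by
    have hmem : ∀ i, φ (u i) ∈ Metric.closedBall (0 : ℝ) (M * ‖φ‖) := fun i => by
      rw [mem_closedBall_zero_iff, mul_comm]
      exact (φ.le_opNorm _).trans (by gcongr; exact hu i)
    obtain ⟨c, hc, hle⟩ := (isCompact_closedBall (0 : ℝ) (M * ‖φ‖)).ultrafilter_le_nhds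
      (l.map fun i => φ (u i)) (by
        rw [le_principal_iff]
        exact Filter.mem_map.2 (Filter.univ_mem' hmem))
    exact ⟨c, by simpa using hc, hle⟩
  choose F hFb hF using hlim
  let F' : StrongDual ℝ (StrongDual ℝ X) := LinearMap.mkContinuous
    { toFun := F
      map_add' := fun φ ψ => tendsto_nhds_unique (hF (φ + ψ)) ((hF φ).add (hF ψ))
      map_smul' := fun c φ => tendsto_nhds_unique (hF (c • φ)) ((hF φ).const_mul c) } M hFb
  obtain ⟨z, hz⟩ := hX F'
  refine ⟨z, fun φ => ?_⟩
  have hzφ : φ z = F φ := DFunLike.congr_fun hz φ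
  rw [hzφ]
  exact hF φ

/-- Closed convex sets contain weak limits of their elements. -/
theorem mem_of_weak_limit {ι : Type*} {l : Filter ι} [l.NeBot] {u : ι → X} {z : X}
    (hz : ∀ φ : StrongDual ℝ X, Tendsto (fun i => φ (u i)) l (𝓝 (φ z))) {s : Set X}
    (hs : Convex ℝ s) (hsc : IsClosed s) (hu : ∀ᶠ i in l, u i ∈ s) : z ∈ s := by
  by_contra hzs
  obtain ⟨φ, c, h1, h2⟩ := geometric_hahn_banach_closed_point hs hsc hzs
  exact absurd (le_of_tendsto (hz φ) (hu.mono fun i hi => (h1 _ hi).le)) h2.not_ge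

/-- A separable subspace admits a countable norming family of functionals. -/
theorem exists_norming_seq (Y : Submodule ℝ X) [TopologicalSpace.SeparableSpace Y] :
    ∃ φ : ℕ → StrongDual ℝ X, (∀ n, ‖φ n‖ ≤ 1) ∧
      ∀ y ∈ Y, ∀ M : ℝ, (∀ n, φ n y ≤ M) → ‖y‖ ≤ M := by
  choose φ h1 h2 using fun n => exists_dual_vector'' ℝ (TopologicalSpace.denseSeq Y n : X)
  refine ⟨φ, h1, fun y hy M hM => le_of_forall_pos_le_add fun ε hε => ?_⟩
  obtain ⟨n, hn⟩ := (TopologicalSpace.denseRange_denseSeq Y).exists_dist_lt ⟨y, hy⟩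
    (half_pos hε)
  let d : X := (TopologicalSpace.denseSeq Y n : Y)
  have hd : ‖y - d‖ < ε / 2 := by rwa [← dist_eq_norm]
  have hφ : ‖φ n (d - y)‖ ≤ ‖y - d‖ := by
    have := (φ n).le_of_opNorm_le (h1 n) (d - y)
    rwa [one_mul, norm_sub_rev d y] at this
  have hφ' := (le_abs_self _).trans hφ
  have hdn : φ n d = ‖d‖ := h2 n
  have htri : ‖y‖ ≤ ‖y - d‖ + ‖d‖ := by simpa using norm_add_le (y - d) d
  rw [map_sub, hdn] at hφ'
  linarith [hM n]

/-- The slopes of a Lipschitz function are bounded. -/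
theorem LipschitzWith.norm_slope_le {g : ℝ → X} {K : ℝ≥0} (hg : LipschitzWith K g) (a b : ℝ) :
    ‖slope g a b‖ ≤ K := by
  rw [slope_def_module, norm_smul, norm_inv]
  have := hg.norm_sub_le b a
  rcases eq_or_ne b a with rfl | hne
  · simp
  · have hpos : 0 < ‖b - a‖ := norm_pos_iff.2 (sub_ne_zero.2 hne)
    rwa [inv_mul_le_iff₀ hpos, mul_comm]

/-- A Lipschitz curve in a reflexive space is differentiable almost everywhere. -/
theorem IsReflexiveBanach.ae_differentiableAt_curve (hX : IsReflexiveBanach X) {g : ℝ → X}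
    {K : ℝ≥0} (hg : LipschitzWith K g) : ∀ᵐ t, DifferentiableAt ℝ g t := by
  set Y : Submodule ℝ X := (Submodule.span ℝ (range g)).topologicalClosure with hY
  have hgY : ∀ t, g t ∈ Y := fun t =>
    Submodule.le_topologicalClosure _ (Submodule.subset_span ⟨t, rfl⟩)
  have hYclosed : IsClosed (Y : Set X) := Submodule.isClosed_topologicalClosure _
  have hYsep : TopologicalSpace.SeparableSpace Y := by
    have : TopologicalSpace.IsSeparable (Y : Set X) :=
      (TopologicalSpace.isSeparable_range hg.continuous).span.closure
    exact this.separableSpace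
  obtain ⟨φ, hφ1, hφ⟩ := exists_norming_seq Y
  let d : ℕ → X := fun k => TopologicalSpace.denseSeq Y k
  have hdY : ∀ k, d k ∈ Y := fun k => (TopologicalSpace.denseSeq Y k).2
  have hlip : ∀ n, LipschitzWith K fun t => φ n (g t) := fun n => by
    refine LipschitzWith.of_dist_le_mul fun a b => ?_
    rw [dist_eq_norm, ← map_sub, dist_eq_norm]
    have := (φ n).le_of_opNorm_le (hφ1 n) (g a - g b)
    exact (this.trans (by rw [one_mul])).trans (hg.norm_sub_le a b)
  let ρ : ℕ → ℝ → ℝ := fun k t => ⨆ n, |deriv (fun s => φ n (g s)) t - φ n (d k)|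
  have hbound : ∀ k t n, |deriv (fun s => φ n (g s)) t - φ n (d k)| ≤ K + ‖d k‖ := by
    intro k t n
    refine (abs_sub _ _).trans (add_le_add ?_ ?_)
    · exact norm_deriv_le_of_lipschitz (hlip n)
    · have := (φ n).le_of_opNorm_le (hφ1 n) (d k)
      rwa [one_mul] at this
  have hbdd : ∀ k t, BddAbove (range fun n => |deriv (fun s => φ n (g s)) t - φ n (d k)|) :=
    fun k t => ⟨K + ‖d k‖, by rintro _ ⟨n, rfl⟩; exact hbound k t n⟩
  have hρ0 : ∀ k t, 0 ≤ ρ k t := fun k t => Real.iSup_nonneg fun n => abs_nonneg _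
  have hρloc : ∀ k, LocallyIntegrable (ρ k) volume := fun k => by
    have hmeas : Measurable (ρ k) := Measurable.iSup fun n =>
      ((measurable_deriv _).sub_const _).abs
    refine (memLp_top_of_bound hmeas.aestronglyMeasurable (K + ‖d k‖)
      (ae_of_all _ fun t => ?_)).locallyIntegrable le_top
    rw [Real.norm_of_nonneg (hρ0 k t)]
    exact ciSup_le fun n => hbound k t n
  have hint : ∀ k t t', ‖g t' - g t - (t' - t) • d k‖ ≤ |∫ s in t..t', ρ k s| := by
    intro k t t'
    refine hφ _ (Y.sub_mem (Y.sub_mem (hgY _) (hgY _)) (Y.smul_mem _ (hdY k))) _ fun n => ?_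
    have hac : AbsolutelyContinuousOnInterval (fun s => φ n (g s)) t t' :=
      ((hlip n).lipschitzOnWith).absolutelyContinuousOnInterval
    have heq : φ n (g t' - g t - (t' - t) • d k) =
        ∫ s in t..t', (deriv (fun s => φ n (g s)) s - φ n (d k)) := by
      rw [intervalIntegral.integral_sub hac.intervalIntegrable_deriv
        intervalIntegrable_const, hac.integral_deriv_eq_sub]
      simp
    rw [heq]
    refine (le_abs_self _).trans ?_
    have hρint : IntervalIntegrable (ρ k) volume t t' :=
      ((hρloc k).integrableOn_isCompact isCompact_uIcc).intervalIntegrable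
    rw [← Real.norm_eq_abs]
    refine intervalIntegral.norm_integral_le_abs_of_norm_le (ae_of_all _ fun s => ?_) hρint
    exact le_ciSup (hbdd k s) n
  have hae : ∀ᵐ t, ∀ n, DifferentiableAt ℝ (fun s => φ n (g s)) t :=
    ae_all_iff.2 fun n => (hlip n).ae_differentiableAt_real
  have hae' : ∀ᵐ t, ∀ k c, HasDerivAt (fun x => ∫ s in c..x, ρ k s) (ρ k t) t :=
    ae_all_iff.2 fun k => LocallyIntegrable.ae_hasDerivAt_integral (hρloc k)
  filter_upwards [hae, hae'] with t ht ht'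
  obtain ⟨h, hh⟩ := hX.exists_weak_limit (Ultrafilter.of (𝓝[≠] t))
    (u := fun t' => slope g t t') (M := K) fun t' => hg.norm_slope_le t t'
  have hhY : h ∈ Y := mem_of_weak_limit hh Y.convex hYclosed <| Eventually.of_forall fun t' => by
    rw [slope_def_module]
    exact Y.smul_mem _ (Y.sub_mem (hgY _) (hgY _))
  have hderiv : ∀ n, deriv (fun s => φ n (g s)) t = φ n h := fun n => by
    have h1 := (hasDerivAt_iff_tendsto_slope.1 (ht n).hasDerivAt).mono_left
      (Ultrafilter.of_le (𝓝[≠] t))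
    refine tendsto_nhds_unique (h1.congr fun t' => ?_) (hh (φ n))
    simp [slope_def_module]
  have hρle : ∀ k, ρ k t ≤ ‖h - d k‖ := fun k => ciSup_le fun n => by
    rw [hderiv, ← map_sub]
    have := (φ n).le_of_opNorm_le (hφ1 n) (h - d k)
    rwa [one_mul] at this
  refine HasDerivAt.differentiableAt (f' := h) ?_
  rw [hasDerivAt_iff_isLittleO, Asymptotics.isLittleO_iff]
  intro ε hε
  obtain ⟨k, hk⟩ := (TopologicalSpace.denseRange_denseSeq Y).exists_dist_lt ⟨h, hhY⟩
    (show 0 < ε / 3 by positivity)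
  have hk' : ‖h - d k‖ < ε / 3 := by rwa [← dist_eq_norm]
  have hev := (Asymptotics.isLittleO_iff.1 (hasDerivAt_iff_isLittleO.1 (ht' k t)))
    (show 0 < ε / 3 by positivity)
  filter_upwards [hev] with t' ht'
  rw [intervalIntegral.integral_same, sub_zero, smul_eq_mul] at ht'
  have e1 : |∫ s in t..t', ρ k s| ≤ ε / 3 * ‖t' - t‖ + ‖t' - t‖ * (ε / 3) := by
    calc |∫ s in t..t', ρ k s| = ‖((∫ s in t..t', ρ k s) - (t' - t) * ρ k t) +
          (t' - t) * ρ k t‖ := by simp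
      _ ≤ ε / 3 * ‖t' - t‖ + ‖(t' - t) * ρ k t‖ := (norm_add_le _ _).trans (by gcongr)
      _ ≤ ε / 3 * ‖t' - t‖ + ‖t' - t‖ * (ε / 3) := by
        rw [norm_mul, Real.norm_of_nonneg (hρ0 k t)]
        gcongr
        exact (hρle k).trans hk'.le
  calc ‖g t' - g t - (t' - t) • h‖
      = ‖(g t' - g t - (t' - t) • d k) - (t' - t) • (h - d k)‖ := by
        congr 1
        rw [smul_sub]
        abel
    _ ≤ |∫ s in t..t', ρ k s| + ‖t' - t‖ * ‖h - d k‖ := by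
        refine (norm_sub_le _ _).trans (add_le_add (hint k t t') ?_)
        rw [norm_smul]
    _ ≤ (ε / 3 * ‖t' - t‖ + ‖t' - t‖ * (ε / 3)) + ‖t' - t‖ * (ε / 3) := by gcongr
    _ = ε * ‖t' - t‖ := by ring

end WeakLimits

section Rademacher

variable {X : Type} [NormedAddCommGroup X] [NormedSpace ℝ X]
  {E : Type*} [NormedAddCommGroup E] [NormedSpace ℝ E] [MeasurableSpace E] [BorelSpace E]
  [FiniteDimensional ℝ E] {μ : Measure E} [μ.IsAddHaarMeasure]

theorem IsReflexiveBanach.ae_lineDifferentiableAt [CompleteSpace X] (hX : IsReflexiveBanach X)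
    {f : E → X} {K : ℝ≥0} (hf : LipschitzWith K f) (v : E) :
    ∀ᵐ p ∂μ, LineDifferentiableAt ℝ f p v := by
  let L : ℝ →L[ℝ] E := ContinuousLinearMap.smulRight (1 : ℝ →L[ℝ] ℝ) v
  suffices A : ∀ p, ∀ᵐ t : ℝ, LineDifferentiableAt ℝ f (p + t • v) v from
    ae_mem_of_ae_add_linearMap_mem L.toLinearMap volume μ
      (measurableSet_lineDifferentiableAt hf.continuous) A
  intro p
  filter_upwards [hX.ae_differentiableAt_curve
    (hf.comp ((LipschitzWith.const p).add L.lipschitz))] with s hs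
  have h's : DifferentiableAt ℝ (fun t ↦ f (p + t • v)) (s + 0) := by
    rw [add_zero]
    exact hs
  have : DifferentiableAt ℝ (fun t ↦ s + t) 0 := differentiableAt_id.const_add _
  simp only [LineDifferentiableAt]
  convert! h's.comp 0 this with _ t
  simp only [add_assoc, Function.comp_apply, add_smul]

/-- **Rademacher's theorem** for Lipschitz maps from a finite-dimensional space to a reflexive
Banach space. -/
theorem IsReflexiveBanach.ae_differentiableAt [CompleteSpace X] (hX : IsReflexiveBanach X)
    {f : E → X} {K : ℝ≥0} (hf : LipschitzWith K f) : ∀ᵐ p ∂μ, DifferentiableAt ℝ f p := by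
  set Y : Submodule ℝ X := (Submodule.span ℝ (range f)).topologicalClosure with hY
  have hfY : ∀ t, f t ∈ Y := fun t =>
    Submodule.le_topologicalClosure _ (Submodule.subset_span ⟨t, rfl⟩)
  have hYclosed : IsClosed (Y : Set X) := Submodule.isClosed_topologicalClosure _
  have hYsep : TopologicalSpace.SeparableSpace Y := by
    have : TopologicalSpace.IsSeparable (Y : Set X) :=
      (TopologicalSpace.isSeparable_range hf.continuous).span.closure
    exact this.separableSpace
  obtain ⟨φ, -, hφ⟩ := exists_norming_seq Y
  have hYeq : ∀ y ∈ Y, (∀ n, φ n y = 0) → y = 0 := fun y hy h =>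
    norm_le_zero_iff.1 (hφ y hy 0 fun n => (h n).le)
  have h1 : ∀ᵐ p ∂μ, ∀ n, DifferentiableAt ℝ (fun x => φ n (f x)) p :=
    ae_all_iff.2 fun n => ((φ n).lipschitz.comp hf).ae_differentiableAt
  let s : ℕ → E := TopologicalSpace.denseSeq E
  have h2 : ∀ᵐ p ∂μ, ∀ k, LineDifferentiableAt ℝ f p (s k) :=
    ae_all_iff.2 fun k => hX.ae_lineDifferentiableAt hf (s k)
  filter_upwards [h1, h2] with p hp1 hp2
  have hlip : ∀ v, LipschitzWith (K * ‖v‖₊) fun t : ℝ => f (p + t • v) := fun v => by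
    refine LipschitzWith.of_dist_le_mul fun a b => (hf.dist_le_mul _ _).trans (le_of_eq ?_)
    rw [dist_add_left, dist_eq_norm, ← sub_smul, norm_smul, dist_eq_norm]
    push_cast
    ring
  let l : Ultrafilter ℝ := Ultrafilter.of (𝓝[≠] 0)
  have hl : (l : Filter ℝ) ≤ 𝓝[≠] 0 := Ultrafilter.of_le _
  choose h hh using fun v => hX.exists_weak_limit l (M := K * ‖v‖₊)
    (u := fun t => slope (fun t : ℝ => f (p + t • v)) 0 t) fun t => (hlip v).norm_slope_le 0 t
  have hhY : ∀ v, h v ∈ Y := fun v =>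
    mem_of_weak_limit (hh v) Y.convex hYclosed <| Eventually.of_forall fun t' => by
      rw [slope_def_module]
      exact Y.smul_mem _ (Y.sub_mem (hfY _) (hfY _))
  have hφh : ∀ n v, φ n (h v) = fderiv ℝ (fun x => φ n (f x)) p v := fun n v => by
    have h3 : HasLineDerivAt ℝ (fun x => φ n (f x)) (fderiv ℝ (fun x => φ n (f x)) p v) p v :=
      (hp1 n).hasFDerivAt.hasLineDerivAt v
    have h4 := (hasDerivAt_iff_tendsto_slope.1 h3).mono_left hl
    refine tendsto_nhds_unique (hh v (φ n)) (h4.congr fun t' => ?_)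
    simp [slope_def_module]
  let L : E →ₗ[ℝ] X :=
    { toFun := h
      map_add' := fun v w => by
        refine sub_eq_zero.1 (hYeq _ (Y.sub_mem (hhY _) (Y.add_mem (hhY _) (hhY _))) fun n => ?_)
        simp [hφh]
      map_smul' := fun c v => by
        refine sub_eq_zero.1 (hYeq _ (Y.sub_mem (hhY _) (Y.smul_mem _ (hhY _))) fun n => ?_)
        simp [hφh] }
  refine HasFDerivAt.differentiableAt (f' := LinearMap.toContinuousLinearMap L)
    (hf.hasFDerivAt_of_hasLineDerivAt_of_closure (s := range s) ?_ ?_)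
  · rw [(TopologicalSpace.denseRange_denseSeq E).closure_eq]
    exact subset_univ _
  · rintro _ ⟨k, rfl⟩
    have h3 := (hp2 k).hasLineDerivAt
    have h4 := (hasDerivAt_iff_tendsto_slope.1 h3).mono_left hl
    have h5 : lineDeriv ℝ f p (s k) = h (s k) := by
      refine (SeparatingDual.eq_iff_forall_dual_eq (R := ℝ)).2 fun ψ => ?_
      exact tendsto_nhds_unique ((ψ.continuous.tendsto _).comp h4) (hh (s k) ψ)
    rw [h5] at h3
    exact h3

end Rademacher

section Cube

/-- The representative in `[0, 1)` of a point of the circle `ℝ / ℤ`. -/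
def unitFract (t : UnitAddCircle) : ℝ := (AddCircle.equivIco 1 0 t : ℝ)

theorem unitFract_mem (t : UnitAddCircle) : unitFract t ∈ Ico (0 : ℝ) 1 := by
  simpa [unitFract] using (AddCircle.equivIco (1 : ℝ) 0 t).2

theorem coe_unitFract (t : UnitAddCircle) : (unitFract t : UnitAddCircle) = t :=
  AddCircle.coe_equivIco

theorem measurable_unitFract : Measurable unitFract :=
  measurable_subtype_coe.comp (AddCircle.measurableEquivIco 1 0).measurable

theorem exists_unitFract_add_coe (t : UnitAddCircle) (r : ℝ) :
    ∃ c : ℤ, unitFract (t + (r : UnitAddCircle)) = unitFract t + r - c := by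
  have h : ((unitFract t + r - unitFract (t + (r : UnitAddCircle)) : ℝ) : UnitAddCircle) = 0 := by
    rw [AddCircle.coe_sub, AddCircle.coe_add, coe_unitFract, coe_unitFract, sub_self]
  obtain ⟨c, hc⟩ := (AddCircle.coe_eq_zero_iff (1 : ℝ)).1 h
  refine ⟨c, ?_⟩
  rw [zsmul_one] at hc
  linarith

/-- The identification of the infinite-dimensional torus with the cube
`{a | 0 ≤ a i < 2⁻ⁱ for all i}` in `ℓ₁`. -/
def cubeMap (k : ℕ → UnitAddCircle) : EllOne :=
  ⟨fun i => unitFract (k i) / 2 ^ i, by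
    refine memℓp_gen ?_
    refine Summable.of_nonneg_of_le (fun i => by positivity) (fun i => ?_)
      summable_geometric_two
    have := unitFract_mem (k i)
    rw [ENNReal.toReal_one, Real.rpow_one, Real.norm_eq_abs,
      abs_of_nonneg (div_nonneg this.1 (by positivity)), one_div, inv_pow, div_eq_mul_inv]
    exact mul_le_of_le_one_left (by positivity) this.2.le⟩

theorem cubeMap_apply (k : ℕ → UnitAddCircle) (i : ℕ) :
    cubeMap k i = unitFract (k i) / 2 ^ i := rfl

theorem stronglyMeasurable_cubeMap : StronglyMeasurable cubeMap := by
  refine stronglyMeasurable_of_tendsto atTop (f := fun (n : ℕ) k =>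
    ∑ i ∈ Finset.range n, lp.single 1 i (cubeMap k i)) (fun n => ?_)
    (tendsto_pi_nhds.2 fun k => (lp.hasSum_single (by simp) (cubeMap k)).tendsto_sum_nat)
  refine Finset.stronglyMeasurable_fun_sum _ fun i _ => ?_
  refine (lp.singleContinuousLinearMap ℝ (fun _ : ℕ => ℝ) 1 i).continuous.comp_stronglyMeasurable
    (f := fun k => cubeMap k i) (Measurable.stronglyMeasurable ?_)
  simp only [cubeMap_apply]
  exact (measurable_unitFract.comp (measurable_pi_apply i)).div_const _

/-- The inclusion of `ℝⁿ` in `ℓ₁` as the span of the first `n` unit vectors. -/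
def finToEllOne (n : ℕ) : (Fin n → ℝ) →L[ℝ] EllOne :=
  ∑ i : Fin n, (lp.singleContinuousLinearMap ℝ (fun _ : ℕ => ℝ) 1 (i : ℕ)).comp
    (ContinuousLinearMap.proj i)

theorem finToEllOne_apply (n : ℕ) (v : Fin n → ℝ) (j : ℕ) :
    finToEllOne n v j = if h : j < n then v ⟨j, h⟩ else 0 := by
  simp only [finToEllOne, sum_apply, ContinuousLinearMap.comp_apply,
    ContinuousLinearMap.proj_apply, lp.singleContinuousLinearMap_apply, lp.coeFn_sum,
    Finset.sum_apply, lp.coeFn_single, Pi.single_apply]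
  split_ifs with h
  · rw [Finset.sum_eq_single ⟨j, h⟩] <;> grind
  · refine Finset.sum_eq_zero fun i _ => if_neg ?_
    omega

/-- The translation of the torus which corresponds under `cubeMap` to translation by
`finToEllOne n v`. -/
def finToTorus (n : ℕ) (v : Fin n → ℝ) : ℕ → UnitAddCircle := fun i =>
  if h : i < n then ((2 ^ i * v ⟨i, h⟩ : ℝ) : UnitAddCircle) else 0

theorem measurable_finToTorus (n : ℕ) : Measurable (finToTorus n) := by
  refine measurable_pi_lambda _ fun i => ?_
  unfold finToTorus
  split_ifs with h
  · exact AddCircle.measurable_mk'.comp ((measurable_pi_apply _).const_mul _)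
  · exact measurable_const

theorem exists_cubeMap_add_finToTorus (n : ℕ) (k : ℕ → UnitAddCircle) (v : Fin n → ℝ) :
    ∃ c : Fin n → ℤ, cubeMap (k + finToTorus n v) =
      cubeMap k + finToEllOne n (v - fun i => (c i : ℝ) / 2 ^ (i : ℕ)) := by
  choose c hc using fun i : Fin n => exists_unitFract_add_coe (k i) (2 ^ (i : ℕ) * v i)
  refine ⟨c, lp.ext (funext fun j => ?_)⟩
  rw [lp.coeFn_add, Pi.add_apply, finToEllOne_apply, cubeMap_apply, cubeMap_apply, Pi.add_apply,
    finToTorus]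
  split_ifs with h
  · rw [hc ⟨j, h⟩, Pi.sub_apply]
    field_simp
    ring
  · simp

/-- A Borel subset of `ℓ₁` which has full Lebesgue measure in every translate of the span of the
first `n` unit vectors has full measure in the cube. -/
theorem ae_cubeMap_mem [MeasurableSpace EllOne] [BorelSpace EllOne] (n : ℕ) {B : Set EllOne}
    (hB : MeasurableSet B) (h : ∀ x, ∀ᵐ v : Fin n → ℝ, x + finToEllOne n v ∈ B) :
    ∀ᵐ k ∂(Measure.addHaar : Measure (ℕ → UnitAddCircle)), cubeMap k ∈ B := by
  have h1 : ∀ k, ∀ᵐ v : Fin n → ℝ, cubeMap (k + finToTorus n v) ∈ B := fun k => by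
    have : ∀ᵐ v : Fin n → ℝ, ∀ c : Fin n → ℤ,
        cubeMap k + finToEllOne n (v - fun i => (c i : ℝ) / 2 ^ (i : ℕ)) ∈ B := by
      refine ae_all_iff.2 fun c => ?_
      exact (eventually_sub_right_iff volume (fun i => (c i : ℝ) / 2 ^ (i : ℕ))
        (p := fun v => cubeMap k + finToEllOne n v ∈ B)).2 (h _)
    filter_upwards [this] with v hv
    obtain ⟨c, hc⟩ := exists_cubeMap_add_finToTorus n k v
    rw [hc]
    exact hv c
  have hmeas : MeasurableSet {p : (Fin n → ℝ) × (ℕ → UnitAddCircle) |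
      cubeMap (p.2 + finToTorus n p.1) ∈ B} :=
    (stronglyMeasurable_cubeMap.measurable.comp
      (measurable_snd.add ((measurable_finToTorus n).comp measurable_fst))) hB
  have h2 : ∀ᵐ v : Fin n → ℝ, ∀ᵐ k ∂(Measure.addHaar : Measure (ℕ → UnitAddCircle)),
      cubeMap (k + finToTorus n v) ∈ B :=
    (Measure.ae_ae_comm hmeas).2 (.of_forall h1)
  obtain ⟨v, hv⟩ := h2.exists
  exact (eventually_add_right_iff _ (finToTorus n v) (p := fun k => cubeMap k ∈ B)).1 hv

/-- A Lipschitz map from `ℓ₁` to a reflexive space has a point at which it is differentiable along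
all the finite-dimensional coordinate subspaces. -/
theorem IsReflexiveBanach.exists_differentiableAt_finToEllOne {X : Type} [NormedAddCommGroup X]
    [NormedSpace ℝ X] [CompleteSpace X] (hX : IsReflexiveBanach X) {f : EllOne → X} {K : ℝ≥0}
    (hf : LipschitzWith K f) :
    ∃ x, ∀ n, DifferentiableAt ℝ (fun v : Fin n → ℝ => f (x + finToEllOne n v)) 0 := by
  borelize EllOne
  have key : ∀ n, ∀ᵐ k ∂(Measure.addHaar : Measure (ℕ → UnitAddCircle)), cubeMap k ∈
      {x : EllOne | DifferentiableAt ℝ (fun v : Fin n → ℝ => f (x + finToEllOne n v)) 0} := by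
    intro n
    have hcont : Continuous (Function.uncurry fun (x : EllOne) (v : Fin n → ℝ) =>
        f (x + finToEllOne n v)) :=
      hf.continuous.comp (continuous_fst.add ((finToEllOne n).continuous.comp continuous_snd))
    refine ae_cubeMap_mem n ((measurableSet_of_differentiableAt_with_param ℝ hcont).preimage
      measurable_prodMk_right) fun x => ?_
    have hlip : LipschitzWith (K * (0 + ‖finToEllOne n‖₊))
        fun v : Fin n → ℝ => f (x + finToEllOne n v) :=
      hf.comp ((LipschitzWith.const x).add (finToEllOne n).lipschitz)
    filter_upwards [hX.ae_differentiableAt (μ := volume) hlip] with v hv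
    have hv' : DifferentiableAt ℝ (fun v : Fin n → ℝ => f (x + finToEllOne n v)) (v + 0) := by
      rwa [add_zero]
    refine (hv'.comp (0 : Fin n → ℝ) (f := fun w => v + w)
      (differentiableAt_id.const_add v)).congr_of_eventuallyEq (.of_forall fun w => ?_)
    simp only [Function.comp, map_add, add_assoc]
  exact ((ae_all_iff.2 key).exists).imp' cubeMap fun k hk => hk

end Cube

section Reflexive

theorem summingNorm_smul (c : ℝ) (a : EllOne) : summingNorm (c • a) = |c| * summingNorm a := by
  simp only [summingNorm, lp.coeFn_smul, Pi.smul_apply, smul_eq_mul, ← Finset.mul_sum, abs_mul]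
  exact (Real.mul_iSup_of_nonneg (abs_nonneg c) _).symm

theorem norm_le_summingNorm_of_nonneg {a : EllOne} (ha : ∀ i, 0 ≤ a i) : ‖a‖ ≤ summingNorm a := by
  rw [a.norm_eq_tsum]
  refine Real.tsum_le_of_sum_range_le (fun _ => abs_nonneg _) fun n => ?_
  rw [Finset.sum_congr rfl fun i _ => abs_of_nonneg (ha i)]
  exact (le_abs_self _).trans (abs_sum_range_le_summingNorm a n)

theorem exists_nonneg_sub_eq (w : EllOne) :
    ∃ p q : EllOne, (∀ i, 0 ≤ p i) ∧ (∀ i, 0 ≤ q i) ∧ p - q = w ∧ ‖p‖ ≤ ‖w‖ ∧ ‖q‖ ≤ ‖w‖ := by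
  have key : ∀ w : EllOne, ∃ p : EllOne, (∀ i, p i = max (w i) 0) ∧ ‖p‖ ≤ ‖w‖ := fun w => by
    have hle : ∀ i, |max (w i) 0| ≤ |w i| := fun i => by
      rcases le_total (w i) 0 with h | h <;> simp [h]
    have hs : Summable fun i => |max (w i) 0| :=
      .of_nonneg_of_le (fun _ => abs_nonneg _) hle w.summable_abs
    refine ⟨⟨fun i => max (w i) 0, memℓp_gen (by simpa using hs)⟩, fun i => rfl, ?_⟩
    rw [EllOne.norm_eq_tsum, EllOne.norm_eq_tsum]
    exact hs.tsum_le_tsum hle w.summable_abs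
  obtain ⟨p, hp, hpn⟩ := key w
  obtain ⟨q, hq, hqn⟩ := key (-w)
  rw [norm_neg] at hqn
  refine ⟨p, q, fun i => (hp i).symm ▸ le_max_right _ _, fun i => (hq i).symm ▸ le_max_right _ _,
    lp.ext (funext fun i => ?_), hpn, hqn⟩
  rw [lp.coeFn_sub, Pi.sub_apply, hp, hq, lp.coeFn_neg, Pi.neg_apply]
  rcases le_total (w i) 0 with h | h <;> simp [h]

theorem lipschitzWith_of_partial_upper_bound {X : Type*} [NormedAddCommGroup X]
    {Δ C : ℝ} {f : EllOne → X} (hΔ : 1 ≤ Δ) (hC : 0 ≤ C)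
    (hf : ∀ x y : EllOne, ‖x - y‖ ≤ Δ * summingNorm (x - y) → ‖f x - f y‖ ≤ C * ‖x - y‖) :
    LipschitzWith (Real.toNNReal (2 * C)) f := by
  refine LipschitzWith.of_dist_le_mul fun x y => ?_
  rw [Real.coe_toNNReal _ (by positivity), dist_eq_norm, dist_eq_norm]
  obtain ⟨p, q, hp, hq, hpq, hpn, hqn⟩ := exists_nonneg_sub_eq (x - y)
  have active : ∀ a : EllOne, (∀ i, 0 ≤ a i) → ‖a‖ ≤ Δ * summingNorm a := fun a ha =>
    (norm_le_summingNorm_of_nonneg ha).trans (le_mul_of_one_le_left (summingNorm_nonneg a) hΔ)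
  have e1 : y + p - y = p := by abel
  have e2 : y + p - x = q := by rw [← sub_sub_cancel p q, hpq]; abel
  have h1 := hf (y + p) y (by rw [e1]; exact active p hp)
  have h2 := hf (y + p) x (by rw [e2]; exact active q hq)
  rw [e1] at h1
  rw [e2, norm_sub_rev] at h2
  calc ‖f x - f y‖ ≤ ‖f x - f (y + p)‖ + ‖f (y + p) - f y‖ := norm_sub_le_norm_sub_add_norm_sub ..
    _ ≤ C * ‖x - y‖ + C * ‖x - y‖ := by
      exact add_le_add (h2.trans (by gcongr)) (h1.trans (by gcongr))
    _ = 2 * C * ‖x - y‖ := by ring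

/-- The inclusion of finitely supported sequences in `ℓ₁`. -/
def finsuppToEllOne : (ℕ →₀ ℝ) →ₗ[ℝ] EllOne :=
  Finsupp.linearCombination ℝ fun i => lp.single 1 i (1 : ℝ)

theorem finsuppToEllOne_single (i : ℕ) (r : ℝ) :
    finsuppToEllOne (Finsupp.single i r) = lp.single 1 i r := by
  rw [finsuppToEllOne, Finsupp.linearCombination_single, ← lp.single_smul, smul_eq_mul, mul_one]

theorem finsuppToEllOne_apply (a : ℕ →₀ ℝ) (j : ℕ) : finsuppToEllOne a j = a j := by
  induction a using Finsupp.induction_linear with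
  | zero => simp
  | add a b ha hb => simp [ha, hb]
  | single i r =>
    rw [finsuppToEllOne_single, lp.coeFn_single, Finsupp.single_apply, Pi.single_apply]
    grind

theorem norm_finsuppToEllOne_of_nonneg {a : ℕ →₀ ℝ} (ha : ∀ i, 0 ≤ a i) :
    ‖finsuppToEllOne a‖ = Finsupp.linearCombination ℝ (fun _ => (1 : ℝ)) a := by
  rw [EllOne.norm_eq_tsum, Finsupp.linearCombination_apply, Finsupp.sum,
    tsum_eq_sum (s := a.support)]
  · exact Finset.sum_congr rfl fun i _ => by
      rw [finsuppToEllOne_apply, abs_of_nonneg (ha i), smul_eq_mul, mul_one]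
  · intro i hi
    rw [finsuppToEllOne_apply, Finsupp.notMem_support_iff.1 hi, abs_zero]

/-- The set of convex combinations of the vectors `u i`, `i ≥ m`. -/
def tailConvexCombinations {X : Type*} [AddCommGroup X] [Module ℝ X] (u : ℕ → X) (m : ℕ) : Set X :=
  Finsupp.linearCombination ℝ u '' {a : ℕ →₀ ℝ | (∀ i, 0 ≤ a i) ∧ (∀ i < m, a i = 0) ∧
    Finsupp.linearCombination ℝ (fun _ => (1 : ℝ)) a = 1}

theorem convex_tailConvexCombinations {X : Type*} [AddCommGroup X] [Module ℝ X] (u : ℕ → X)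
    (m : ℕ) : Convex ℝ (tailConvexCombinations u m) := by
  refine Convex.linear_image ?_ _
  rintro a ⟨ha, ha', ha''⟩ b ⟨hb, hb', hb''⟩ s t hs ht hst
  refine ⟨fun i => ?_, fun i hi => ?_, ?_⟩
  · have := ha i
    have := hb i
    simp only [Finsupp.add_apply, Finsupp.smul_apply, smul_eq_mul]
    positivity
  · simp [ha' i hi, hb' i hi]
  · rw [map_add, map_smul, map_smul, ha'', hb'', smul_eq_mul, smul_eq_mul, mul_one, mul_one, hst]

theorem mem_tailConvexCombinations {X : Type*} [AddCommGroup X] [Module ℝ X] (u : ℕ → X)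
    {m i : ℕ} (hi : m ≤ i) : u i ∈ tailConvexCombinations u m := by
  refine ⟨Finsupp.single i 1, ⟨fun j => ?_, fun j hj => ?_, by simp⟩, by simp⟩
  · rw [Finsupp.single_apply]
    split_ifs <;> simp
  · exact Finsupp.single_eq_of_ne (by omega)

variable {X : Type} [NormedAddCommGroup X] [NormedSpace ℝ X]

/-- In a reflexive space, every bounded sequence has convex combinations of an initial segment
and of the complementary tail which are arbitrarily close to each other. -/
theorem IsReflexiveBanach.exists_norm_linearCombination_sub_lt (hX : IsReflexiveBanach X)
    {u : ℕ → X} {M : ℝ} (hu : ∀ i, ‖u i‖ ≤ M) {ε : ℝ} (hε : 0 < ε) :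
    ∃ (n : ℕ) (a b : ℕ →₀ ℝ), (∀ i, 0 ≤ a i) ∧ (∀ i, 0 ≤ b i) ∧ (∀ i, n ≤ i → a i = 0) ∧
      (∀ i < n, b i = 0) ∧ Finsupp.linearCombination ℝ (fun _ => (1 : ℝ)) a = 1 ∧
      Finsupp.linearCombination ℝ (fun _ => (1 : ℝ)) b = 1 ∧
      ‖Finsupp.linearCombination ℝ u (a - b)‖ < ε := by
  obtain ⟨z, hz⟩ := hX.exists_weak_limit (hyperfilter ℕ) hu
  have hmem : ∀ m, z ∈ closure (tailConvexCombinations u m) := fun m => by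
    refine mem_of_weak_limit hz (convex_tailConvexCombinations u m).closure isClosed_closure ?_
    have : ∀ᶠ i in atTop, u i ∈ closure (tailConvexCombinations u m) :=
      (eventually_ge_atTop m).mono fun i hi => subset_closure (mem_tailConvexCombinations u hi)
    exact Nat.hyperfilter_le_atTop this
  obtain ⟨_, ⟨a, ⟨ha, -, ha1⟩, rfl⟩, hza⟩ := Metric.mem_closure_iff.1 (hmem 0) _ (half_pos hε)
  obtain ⟨_, ⟨b, ⟨hb, hb0, hb1⟩, rfl⟩, hzb⟩ :=
    Metric.mem_closure_iff.1 (hmem (a.support.sup id + 1)) _ (half_pos hε)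
  refine ⟨a.support.sup id + 1, a, b, ha, hb, fun i hi => ?_, hb0, ha1, hb1, ?_⟩
  · by_contra hne
    have : id i ≤ a.support.sup id := Finset.le_sup (Finsupp.mem_support_iff.2 hne)
    simp only [id] at this hi
    omega
  · rw [map_sub, ← dist_eq_norm]
    rw [dist_comm] at hza
    linarith [dist_triangle (Finsupp.linearCombination ℝ u a) z (Finsupp.linearCombination ℝ u b)]

/-- A Lipschitz map from `ℓ₁` to a reflexive space has a point at which all directional derivatives
along finitely supported directions exist and depend linearly on the direction. -/
theorem IsReflexiveBanach.exists_hasDerivAt_finsupp [CompleteSpace X] (hX : IsReflexiveBanach X)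
    {f : EllOne → X} {K : ℝ≥0} (hf : LipschitzWith K f) :
    ∃ (x : EllOne) (u : ℕ → X), ∀ a : ℕ →₀ ℝ,
      HasDerivAt (fun t : ℝ => f (x + t • finsuppToEllOne a))
        (Finsupp.linearCombination ℝ u a) 0 := by
  obtain ⟨x, hx⟩ := hX.exists_differentiableAt_finToEllOne hf
  let D : ∀ n, (Fin n → ℝ) →L[ℝ] X := fun n =>
    fderiv ℝ (fun v : Fin n → ℝ => f (x + finToEllOne n v)) 0
  have hD : ∀ n v, HasDerivAt (fun t : ℝ => f (x + t • finToEllOne n v)) (D n v) 0 := by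
    intro n v
    have h1 : HasFDerivAt (fun v : Fin n → ℝ => f (x + finToEllOne n v)) (D n) ((0 : ℝ) • v) := by
      rw [zero_smul]
      exact (hx n).hasFDerivAt
    have h2 : HasDerivAt (fun t : ℝ => t • v) v 0 := by
      simpa using (hasDerivAt_id (0 : ℝ)).smul_const v
    simpa [Function.comp_def] using h1.comp_hasDerivAt (0 : ℝ) h2
  have hL : ∀ (n : ℕ) (a : ℕ →₀ ℝ), (∀ i, n ≤ i → a i = 0) →
      finToEllOne n (fun i => a i) = finsuppToEllOne a := by
    intro n a ha
    refine lp.ext (funext fun j => ?_)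
    rw [finToEllOne_apply, finsuppToEllOne_apply]
    split_ifs with h
    · rfl
    · exact (ha j (not_lt.1 h)).symm
  refine ⟨x, fun i => D (i + 1) fun j => Finsupp.single i (1 : ℝ) (j : ℕ), fun a => ?_⟩
  set n := a.support.sup id + 1 with hn
  have ha : ∀ i, n ≤ i → a i = 0 := fun i hi => by
    by_contra hne
    have : id i ≤ a.support.sup id := Finset.le_sup (Finsupp.mem_support_iff.2 hne)
    simp only [id] at this
    omega
  have hu : ∀ i : Fin n, D n (Pi.single i 1) =
      D (i + 1) fun j => Finsupp.single (i : ℕ) (1 : ℝ) (j : ℕ) := fun i => by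
    have h1 := hD n (Pi.single i 1)
    have h2 := hD (i + 1) fun j => Finsupp.single (i : ℕ) (1 : ℝ) (j : ℕ)
    have e : (Pi.single i 1 : Fin n → ℝ) =
        fun j : Fin n => Finsupp.single (i : ℕ) (1 : ℝ) (j : ℕ) := by
      funext j
      rw [Pi.single_apply, Finsupp.single_apply]
      grind
    rw [e] at h1 ⊢
    rw [hL _ _ fun j hj => Finsupp.single_eq_of_ne (by omega)] at h1 h2
    exact h1.unique h2
  have hsum : D n (fun i => a i) = Finsupp.linearCombination ℝ
      (fun i => D (i + 1) fun j => Finsupp.single i (1 : ℝ) (j : ℕ)) a := by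
    rw [Finsupp.linearCombination_apply, Finsupp.sum_of_support_subset a
      (s := Finset.range n) _ _ (by simp), Finset.sum_range]
    · conv_lhs => rw [pi_eq_sum_univ' (fun i : Fin n => a i), map_sum]
      refine Finset.sum_congr rfl fun i _ => ?_
      rw [← hu, map_smul]
    · intro i hi
      rw [Finset.mem_range]
      by_contra hle
      exact Finsupp.mem_support_iff.1 hi (ha i (not_lt.1 hle))
  rw [← hsum, ← hL n a ha]
  exact hD n _

variable {Δ C : ℝ} {f : EllOne → X}

/-- Directional derivatives of a partially bilipschitz map along active directions inherit the
bilipschitz bounds. -/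
theorem norm_hasDerivAt_mem_Icc_of_partial_bilipschitz
    (hf : ∀ x y : EllOne, ‖x - y‖ ≤ Δ * summingNorm (x - y) →
      ‖x - y‖ ≤ ‖f x - f y‖ ∧ ‖f x - f y‖ ≤ C * ‖x - y‖)
    {x w : EllOne} {d : X} (hd : HasDerivAt (fun t : ℝ => f (x + t • w)) d 0)
    (hw : ‖w‖ ≤ Δ * summingNorm w) : ‖w‖ ≤ ‖d‖ ∧ ‖d‖ ≤ C * ‖w‖ := by
  have hlim := (hasDerivAt_iff_tendsto_slope_zero.1 hd).norm
  have hbound : ∀ t : ℝ, t ≠ 0 →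
      ‖t⁻¹ • (f (x + (0 + t) • w) - f (x + (0 : ℝ) • w))‖ ∈ Icc ‖w‖ (C * ‖w‖) := by
    intro t ht
    have e : x + (0 + t) • w - (x + (0 : ℝ) • w) = t • w := by
      rw [zero_add, zero_smul, add_zero, add_sub_cancel_left]
    have ht' : 0 < |t| := abs_pos.2 ht
    have h := hf (x + (0 + t) • w) (x + (0 : ℝ) • w) (by
      rw [e, summingNorm_smul, norm_smul, Real.norm_eq_abs, mul_left_comm]
      gcongr)
    rw [e, norm_smul t w, Real.norm_eq_abs] at h
    rw [norm_smul, norm_inv, Real.norm_eq_abs]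
    constructor
    · rw [le_inv_mul_iff₀ ht']
      exact h.1
    · rw [inv_mul_le_iff₀ ht']
      linarith [h.2]
  exact isClosed_Icc.mem_of_tendsto hlim (eventually_mem_nhdsWithin.mono hbound)

/-- A reflexive Banach space admits no partially bilipschitz embedding of `ℓ₁`. -/
theorem IsReflexiveBanach.not_partial_bilipschitz [CompleteSpace X] (hX : IsReflexiveBanach X)
    (hΔ : 2 ≤ Δ) (hC : 0 ≤ C) :
    ¬ ∀ x y : EllOne, ‖x - y‖ ≤ Δ * summingNorm (x - y) →
      ‖x - y‖ ≤ ‖f x - f y‖ ∧ ‖f x - f y‖ ≤ C * ‖x - y‖ := by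
  intro hf
  obtain ⟨x, u, hu⟩ := hX.exists_hasDerivAt_finsupp
    (lipschitzWith_of_partial_upper_bound (by linarith) hC fun x y hxy => (hf x y hxy).2)
  have hbd : ∀ i, ‖u i‖ ≤ C := fun i => by
    have hpos : ∀ j, 0 ≤ finsuppToEllOne (Finsupp.single i 1) j := fun j => by
      rw [finsuppToEllOne_apply, Finsupp.single_apply]
      split_ifs <;> simp
    have h := (norm_hasDerivAt_mem_Icc_of_partial_bilipschitz hf (hu (Finsupp.single i 1))
      ((norm_le_summingNorm_of_nonneg hpos).trans
        (le_mul_of_one_le_left (summingNorm_nonneg _) (by linarith)))).2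
    rwa [finsuppToEllOne_single, lp.norm_single (by simp), norm_one, mul_one,
      Finsupp.linearCombination_single, one_smul] at h
  obtain ⟨n, a, b, ha, hb, ha0, hb0, ha1, hb1, hlt⟩ :=
    hX.exists_norm_linearCombination_sub_lt hbd one_pos
  set w := finsuppToEllOne (a - b) with hw
  have hpartial : ∑ i ∈ Finset.range n, w i = 1 := by
    rw [← ha1, Finsupp.linearCombination_apply, Finsupp.sum_of_support_subset a
      (s := Finset.range n) _ _ (by simp)]
    · refine Finset.sum_congr rfl fun i hi => ?_
      rw [hw, finsuppToEllOne_apply, Finsupp.sub_apply, hb0 i (Finset.mem_range.1 hi), sub_zero,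
        smul_eq_mul, mul_one]
    · intro i hi
      rw [Finset.mem_range]
      by_contra hle
      exact Finsupp.mem_support_iff.1 hi (ha0 i (not_lt.1 hle))
  have hs : 1 ≤ summingNorm w := by
    simpa [hpartial] using abs_sum_range_le_summingNorm w n
  have hn1 : 1 ≤ ‖w‖ := by
    simpa [hpartial] using abs_sum_range_le_norm w n
  have hn2 : ‖w‖ ≤ 2 := by
    rw [hw, map_sub]
    refine (norm_sub_le _ _).trans ?_
    rw [norm_finsuppToEllOne_of_nonneg ha, norm_finsuppToEllOne_of_nonneg hb, ha1, hb1]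
    norm_num
  have := (norm_hasDerivAt_mem_Icc_of_partial_bilipschitz hf (hu (a - b)) (by
    rw [← hw]; nlinarith)).1
  rw [← hw] at this
  linarith

end Reflexive

/-- Submetric test-space characterization of reflexivity: for a fixed `Δ ≥ 2`, a Banach
space `X` is nonreflexive iff there is a partially bilipschitz embedding `f : ℓ₁ → X`
whose active pairs are the pairs `(x,y)` with `‖x − y‖₁ ≤ Δ‖x − y‖ₛ`. -/
theorem submetric_characterization_of_reflexivity
    (Δ : ℝ) (hΔ : 2 ≤ Δ)
    (X : Type) [NormedAddCommGroup X] [NormedSpace ℝ X] [CompleteSpace X] :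
    ¬ IsReflexiveBanach X ↔
      ∃ C : ℝ, 1 ≤ C ∧ ∃ f : lp (fun _ : ℕ => ℝ) 1 → X,
        ∀ x y : lp (fun _ : ℕ => ℝ) 1, ‖x - y‖ ≤ Δ * summingNorm (x - y) →
          ‖x - y‖ ≤ ‖f x - f y‖ ∧ ‖f x - f y‖ ≤ C * ‖x - y‖ := by
  refine ⟨exists_partial_bilipschitz_of_not_reflexive hΔ, ?_⟩
  rintro ⟨C, hC, f, hf⟩ hX
  exact hX.not_partial_bilipschitz hΔ (zero_le_one.trans hC) hf
end
end
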